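/- arXiv:math/0008041 — 6 statements merged into one kernel-verified Lean document; each statement's English description precedes it below -/
import Mathlib

section
/- Let 1 ≤ i ≤ n and let m_i, m_{i+1}, …, m_n ∈ F with m_i ≠ 0 and Σ_{j=i}^n x_j·m_j = 0. Then there exists j with i < j ≤ n such that m_j ≠ 0 and in(m_j) ≻ in(m_i); in particular, m_i and m_j are linearly independent over K. -/
open MvPolynomial

noncomputable section

/-- `μ` is a monomial (exponent vector together with basis index) of `f` in the free
module `F = ⊕_u S·g_u`, encoded as `Fin r → MvPolynomial (Fin n) K`. -/
def IsMonomialOf {K : Type*} [Field K] {n r : ℕ}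
    (f : Fin r → MvPolynomial (Fin n) K) (μ : (Fin n →₀ ℕ) × Fin r) : Prop :=
  coeff μ.1 (f μ.2) ≠ 0

/-- `μ` is the `≻`-largest monomial of `f`, i.e. `μ = in(f)`. -/
def IsInitialMonomial {K : Type*} [Field K] {n r : ℕ}
    (prec : ((Fin n →₀ ℕ) × Fin r) → ((Fin n →₀ ℕ) × Fin r) → Prop)
    (f : Fin r → MvPolynomial (Fin n) K) (μ : (Fin n →₀ ℕ) × Fin r) : Prop :=
  IsMonomialOf f μ ∧ ∀ ν, IsMonomialOf f ν → ν ≠ μ → prec μ ν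

/-- A nonzero vector of polynomials has an initial monomial for any strict total order. -/
theorem exists_isInitialMonomial {K : Type*} [Field K] {n r : ℕ}
    (prec : ((Fin n →₀ ℕ) × Fin r) → ((Fin n →₀ ℕ) × Fin r) → Prop)
    (htrans : ∀ a b c, prec a b → prec b c → prec a c)
    (hirrefl : ∀ a, ¬ prec a a)
    (htotal : ∀ a b, a ≠ b → prec a b ∨ prec b a)
    {f : Fin r → MvPolynomial (Fin n) K} (hf : f ≠ 0) :
    ∃ μ, IsInitialMonomial prec f μ := by
  have hfin : {μ | IsMonomialOf f μ}.Finite := by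
    refine (Set.finite_iUnion fun u : Fin r =>
      ((f u).support.finite_toSet.image fun a => (a, u))).subset ?_
    rintro ⟨a, u⟩ h
    exact Set.mem_iUnion.2 ⟨u, a, mem_support_iff.2 h, rfl⟩
  obtain ⟨u, hu⟩ := Function.ne_iff.1 hf
  obtain ⟨a, ha⟩ := ne_zero_iff.1 hu
  have : IsStrictOrder _ prec := { irrefl := hirrefl, trans := htrans }
  obtain ⟨⟨μ, hμ⟩, -, hmax⟩ := (hfin.wellFoundedOn (r := prec)).has_min Set.univ
    ⟨⟨(a, u), ha⟩, trivial⟩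
  exact ⟨μ, hμ, fun ν hν hne =>
    (htotal μ ν hne.symm).resolve_right (hmax ⟨ν, hν⟩ trivial)⟩

/-- Lemma 2.8: if `m_i ≠ 0` and `Σ_{j ≥ i} x_j · m_j = 0`, then some
`m_j` with `j > i` is nonzero with `in(m_j) ≻ in(m_i)`; in particular `m_i, m_j` are
`K`-linearly independent. Here `≻` is a linear order on the monomials of the free
module `F` compatible with multiplication and with `x_1 g_u ≻ ⋯ ≻ x_n g_u`. -/
theorem initial_term_jump {K : Type*} [Field K] {n : ℕ} (hn : 1 ≤ n) (r : ℕ)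
    (prec : ((Fin n →₀ ℕ) × Fin r) → ((Fin n →₀ ℕ) × Fin r) → Prop)
    (htrans : ∀ a b c, prec a b → prec b c → prec a c)
    (hirrefl : ∀ a, ¬ prec a a)
    (htotal : ∀ a b, a ≠ b → prec a b ∨ prec b a)
    (hmul : ∀ (a b : Fin n →₀ ℕ) (u v : Fin r) (c : Fin n →₀ ℕ),
      prec (a, u) (b, v) → prec (a + c, u) (b + c, v))
    (hvar : ∀ (i j : Fin n) (u : Fin r), i < j →
      prec (Finsupp.single i 1, u) (Finsupp.single j 1, u))
    (i : Fin n) (m : Fin n → (Fin r → MvPolynomial (Fin n) K))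
    (hmi : m i ≠ 0)
    (hcycle : ∑ j ∈ Finset.Ici i, (X j : MvPolynomial (Fin n) K) • m j = 0) :
    ∃ j : Fin n, i < j ∧ m j ≠ 0 ∧
      (∀ μi μj, IsInitialMonomial prec (m i) μi → IsInitialMonomial prec (m j) μj →
        prec μj μi) ∧
      LinearIndependent K ![m i, m j] := by
  obtain ⟨⟨a, u⟩, ha, hmax⟩ := exists_isInitialMonomial prec htrans hirrefl htotal hmi
  have hsum : ∑ j ∈ Finset.Ici i,
      coeff (a + Finsupp.single i 1) ((X j : MvPolynomial (Fin n) K) * m j u) = 0 := by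
    have h := congrArg (coeff (a + Finsupp.single i 1)) (congrFun hcycle u)
    simpa [Finset.sum_apply, coeff_sum] using h
  have hlead : coeff (a + Finsupp.single i 1) ((X i : MvPolynomial (Fin n) K) * m i u) ≠ 0 := by
    rw [add_comm, coeff_X_mul]
    exact ha
  obtain ⟨j, hj, hji, hcoeff⟩ : ∃ j ∈ Finset.Ici i, j ≠ i ∧
      coeff (a + Finsupp.single i 1) ((X j : MvPolynomial (Fin n) K) * m j u) ≠ 0 := by
    by_contra! h
    exact hlead (by rwa [Finset.sum_eq_single_of_mem i (Finset.mem_Ici.2 le_rfl) h] at hsum)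
  have hij : i < j := lt_of_le_of_ne (Finset.mem_Ici.1 hj) hji.symm
  obtain ⟨b, hb, hab⟩ : ∃ b, coeff b (m j u) ≠ 0 ∧
      b + Finsupp.single j 1 = a + Finsupp.single i 1 := by
    rw [coeff_X_mul'] at hcoeff
    split_ifs at hcoeff with hmem
    · refine ⟨_, hcoeff, tsub_add_cancel_of_le ?_⟩
      rw [Finsupp.single_le_iff]
      exact Nat.one_le_iff_ne_zero.2 (Finsupp.mem_support_iff.1 hmem)
    · exact absurd rfl hcoeff
  have hvar' : prec (b + Finsupp.single j 1, u) (a + Finsupp.single j 1, u) := by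
    rw [hab, add_comm a, add_comm a]
    exact hmul _ _ _ _ a (hvar i j u hij)
  have hba : prec (b, u) (a, u) := by
    refine (htotal (b, u) (a, u) ?_).resolve_right fun h =>
      hirrefl _ (htrans _ _ _ hvar' (hmul _ _ _ _ (Finsupp.single j 1) h))
    intro h
    rw [(Prod.mk.inj h).1] at hvar'
    exact hirrefl _ hvar'
  have hbi : coeff b (m i u) = 0 := by
    by_contra h
    have hne : (b, u) ≠ (a, u) := fun h => hirrefl (a, u) (by rwa [h] at hba)
    exact hirrefl _ (htrans _ _ _ hba (hmax (b, u) h hne))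
  refine ⟨j, hij, ?_, ?_, ?_⟩
  · intro h
    simp [h] at hb
  · intro μi μj hμi hμj
    have hμa : μi = (a, u) := by
      by_contra hne
      exact hirrefl _ (htrans _ _ _ (hmax μi hμi.1 hne) (hμi.2 (a, u) ha (Ne.symm hne)))
    rw [hμa]
    by_cases hμb : (b, u) = μj
    · rwa [← hμb]
    · exact htrans _ _ _ (hμj.2 (b, u) hb hμb) hba
  · rw [LinearIndependent.pair_iff]
    intro s t hst
    have ht : t = 0 := by
      have h := congrArg (coeff b) (congrFun hst u)
      simpa [hbi, hb] using h
    subst ht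
    exact ⟨by simpa [hmi] using hst, rfl⟩
end
end

section
/- Let p ∈ {0,…,n} and t ∈ ℤ, and let (m_J), indexed by the p-element subsets J of {1,…,n}, be a family of elements of F, each homogeneous of degree t and not all zero, satisfying: for every (p−1)-element subset L of {1,…,n}, Σ_{k ∈ {1,…,n}∖L} (−1)^{|{l ∈ L : l < k}|} x_k·m_{L∪{k}} = 0 (i.e., (m_J) is a nonzero homogeneous cycle of homological degree p of the Koszul complex of x_1,…,x_n with values in F). Then there exist p+1 distinct p-element subsets J_0,…,J_p of {1,…,n} such that m_{J_0},…,m_{J_p} are linearly independent over K. -/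
open MvPolynomial

noncomputable section

/-- The sign of inserting `k` into the ordered set `L`. -/
def insertSign {n : ℕ} (k : Fin n) (L : Finset (Fin n)) : ℤ :=
  (-1) ^ (L.filter (fun l => l < k)).card

theorem insertSign_mul_self {n : ℕ} (k : Fin n) (L : Finset (Fin n)) :
    insertSign k L * insertSign k L = 1 := by
  rw [insertSign, ← mul_pow]
  simp

theorem insertSign_mul_insertSign_insert {n : ℕ} {j k : Fin n} {L : Finset (Fin n)}
    (hj : j ∉ L) (hk : k ∉ L) (hjk : j ≠ k) :
    insertSign j L * insertSign k (insert j L) =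
      -(insertSign k L * insertSign j (insert k L)) := by
  unfold insertSign
  rw [Finset.filter_insert, Finset.filter_insert]
  rcases lt_or_gt_of_ne hjk with h | h
  · rw [if_pos h, if_neg h.not_gt, Finset.card_insert_of_notMem (by simp [hj])]
    ring
  · rw [if_neg h.not_gt, if_pos h, Finset.card_insert_of_notMem (by simp [hk])]
    ring

theorem coeff_zsmul {R σ : Type*} [CommRing R] (e : σ →₀ ℕ) (z : ℤ) (f : MvPolynomial σ R) :
    coeff e (z • f) = z • coeff e f :=
  map_zsmul (coeffAddMonoidHom e) z f

section Contraction

variable {K : Type*} [Field K] {n r : ℕ}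

/-- The contraction of a Koszul chain with values in a free module along the `k`-th coordinate. -/
def contraction (k : Fin n) (m : Finset (Fin n) → (Fin r → MvPolynomial (Fin n) K))
    (L : Finset (Fin n)) : Fin r → MvPolynomial (Fin n) K :=
  if k ∈ L then 0 else insertSign k L • m (insert k L)

/-- The condition that a chain of the Koszul complex of the variables is a cycle. -/
def IsKoszulCycle (m : Finset (Fin n) → (Fin r → MvPolynomial (Fin n) K)) : Prop :=
  ∀ L : Finset (Fin n),
    ∑ k ∈ Lᶜ, insertSign k L • ((X k : MvPolynomial (Fin n) K) • m (insert k L)) = 0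

variable {m : Finset (Fin n) → (Fin r → MvPolynomial (Fin n) K)}

theorem IsKoszulCycle.contraction (hm : IsKoszulCycle m) (k : Fin n) :
    IsKoszulCycle (contraction k m) := by
  intro L
  by_cases hk : k ∈ L
  · exact Finset.sum_eq_zero fun j _ => by simp [_root_.contraction, hk]
  have hkL : k ∈ Lᶜ := by simpa using hk
  have hcompl : (insert k L)ᶜ = Lᶜ.erase k := Finset.compl_insert
  have h := hm (insert k L)
  rw [hcompl] at h
  rw [← Finset.add_sum_erase _ _ hkL]
  have hzero : _root_.contraction k m (insert k L) = 0 := by simp [_root_.contraction]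
  rw [hzero, smul_zero, smul_zero, zero_add]
  calc _ = ∑ j ∈ Lᶜ.erase k, (-insertSign k L) •
        (insertSign j (insert k L) •
          ((X j : MvPolynomial (Fin n) K) • m (insert j (insert k L)))) := by
        refine Finset.sum_congr rfl fun j hj => ?_
        obtain ⟨hjk, hjL⟩ := Finset.mem_erase.1 hj
        have hjL : j ∉ L := by simpa using hjL
        have hkj : k ∉ insert j L := by simp [hk, hjk.symm]
        rw [_root_.contraction, if_neg hkj, smul_comm (X j : MvPolynomial (Fin n) K), smul_smul,
          smul_smul, insertSign_mul_insertSign_insert hjL hk hjk, Finset.insert_comm, neg_mul]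
    _ = 0 := by rw [← Finset.smul_sum, h, smul_zero]

theorem contraction_mem_span (k : Fin n) (L : Finset (Fin n)) :
    contraction k m L ∈ Submodule.span K (Set.range m) := by
  unfold contraction
  split_ifs
  · exact zero_mem _
  · exact zsmul_mem (Submodule.subset_span (Set.mem_range_self _)) _

theorem contraction_ne_zero {k : Fin n} {J : Finset (Fin n)} (hk : k ∈ J) (hJ : m J ≠ 0) :
    contraction k m ≠ 0 := by
  intro h
  have h' := congrFun h (J.erase k)
  rw [contraction, if_neg (Finset.notMem_erase k J), Finset.insert_erase hk] at h'
  apply hJ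
  rw [← one_zsmul (m J), ← insertSign_mul_self k (J.erase k), mul_smul, h']
  simp

/-- Some exponent occurring in a nonzero cycle does not occur in its contraction along `k`. -/
theorem IsKoszulCycle.exists_coeff_contraction_eq_zero (hm : IsKoszulCycle m) (hne : m ≠ 0)
    (k : Fin n) : ∃ (J : Finset (Fin n)) (u : Fin r) (e : Fin n →₀ ℕ),
      coeff e (m J u) ≠ 0 ∧ ∀ L, coeff e (_root_.contraction k m L u) = 0 := by
  let s : Finset (Fin n →₀ ℕ) :=
    Finset.univ.biUnion fun q : Finset (Fin n) × Fin r => (m q.1 q.2).support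
  have mem_s (J u) (e : Fin n →₀ ℕ) (h : coeff e (m J u) ≠ 0) : e ∈ s :=
    Finset.mem_biUnion.2 ⟨(J, u), Finset.mem_univ _, mem_support_iff.2 h⟩
  have hs : s.Nonempty := by
    obtain ⟨J, hJ⟩ := Function.ne_iff.1 hne
    obtain ⟨u, hu⟩ := Function.ne_iff.1 hJ
    obtain ⟨e, he⟩ := ne_zero_iff.1 hu
    exact ⟨e, mem_s J u e he⟩
  obtain ⟨e, hes, hmax⟩ := s.exists_max_image (fun e => e k) hs
  obtain ⟨⟨J, u⟩, -, he⟩ := Finset.mem_biUnion.1 hes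
  refine ⟨J, u, e, mem_support_iff.1 he, fun L => ?_⟩
  unfold _root_.contraction
  split_ifs with hk
  · simp
  have h := congrArg (coeff (e + Finsupp.single k 1)) (congrFun (hm L) u)
  rw [Finset.sum_apply, coeff_sum, Finset.sum_eq_single_of_mem k (by simpa using hk)] at h
  · rw [Pi.smul_apply, Pi.smul_apply, smul_eq_mul, coeff_zsmul, add_comm, coeff_X_mul,
      Pi.zero_apply, coeff_zero] at h
    rw [Pi.smul_apply, coeff_zsmul, h]
  · intro j _ hjk
    have hcoeff : coeff (e + Finsupp.single k 1) (X j * m (insert j L) u) = 0 := by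
      rw [coeff_X_mul']
      split_ifs
      · by_contra hc
        have := hmax _ (mem_s _ _ _ hc)
        simp [hjk.symm] at this
      · rfl
    rw [Pi.smul_apply, Pi.smul_apply, smul_eq_mul, coeff_zsmul, hcoeff, smul_zero]

theorem IsKoszulCycle.succ_le_finrank_span (p : ℕ) (hm : IsKoszulCycle m)
    (hcard : ∀ J : Finset (Fin n), J.card ≠ p → m J = 0) (hne : m ≠ 0) :
    p + 1 ≤ Module.finrank K (Submodule.span K (Set.range m)) := by
  induction p generalizing m with
  | zero =>
    have := FiniteDimensional.span_of_finite K (Set.finite_range m)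
    rw [zero_add, Submodule.one_le_finrank_iff, Ne, Submodule.span_eq_bot]
    intro h
    exact hne (funext fun J => h _ ⟨J, rfl⟩)
  | succ p ih =>
    have := FiniteDimensional.span_of_finite K (Set.finite_range m)
    obtain ⟨J, hJ⟩ := Function.ne_iff.1 hne
    have hJcard : J.card = p + 1 := by
      by_contra h
      exact hJ (hcard J h)
    obtain ⟨k, hk⟩ := Finset.card_pos.1 (by rw [hJcard]; exact p.succ_pos : 0 < J.card)
    have hle := ih (hm.contraction k) (fun L hL => by
      unfold _root_.contraction
      split_ifs with hkL
      · rfl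
      · rw [hcard _ (by rw [Finset.card_insert_of_notMem hkL]; omega), smul_zero])
      (contraction_ne_zero hk hJ)
    obtain ⟨J', u, e, he, hzero⟩ := hm.exists_coeff_contraction_eq_zero hne k
    let φ : (Fin r → MvPolynomial (Fin n) K) →ₗ[K] K := lcoeff K e ∘ₗ LinearMap.proj u
    have hlt : Submodule.span K (Set.range (_root_.contraction k m)) <
        Submodule.span K (Set.range m) := by
      refine lt_of_le_of_ne (Submodule.span_le.2 ?_) fun heq => he ?_
      · rintro _ ⟨L, rfl⟩
        exact contraction_mem_span k L
      · have hker : Submodule.span K (Set.range (_root_.contraction k m)) ≤ LinearMap.ker φ := by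
          rw [Submodule.span_le]
          rintro _ ⟨L, rfl⟩
          exact hzero L
        exact hker (heq ▸ Submodule.subset_span ⟨J', rfl⟩)
    have := Submodule.finrank_lt_finrank_of_lt hlt
    omega

end Contraction

/-- Corollary 2.10: a nonzero homogeneous cycle of homological
degree `p` of the Koszul complex of `x_1, …, x_n` with values in a graded free module
`F = ⊕_u S·g_u` (with `deg g_u = w u`) has `p + 1` coefficients that are `K`-linearly
independent. -/
theorem cycle_coefficients_linearly_independent {K : Type*} [Field K] {n : ℕ} (hn : 1 ≤ n)
    (r : ℕ) (w : Fin r → ℤ) (p : ℕ) (hpn : p ≤ n) (t : ℤ)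
    (m : Finset (Fin n) → (Fin r → MvPolynomial (Fin n) K))
    (hcard : ∀ J : Finset (Fin n), J.card ≠ p → m J = 0)
    (hhom : ∀ (J : Finset (Fin n)) (u : Fin r) (e : Fin n →₀ ℕ),
      coeff e (m J u) ≠ 0 → (e.sum fun _ a => (a : ℤ)) = t - w u)
    (hne : m ≠ 0)
    (hcycle : ∀ L : Finset (Fin n),
      ∑ k ∈ Lᶜ, ((-1 : ℤ) ^ (L.filter (fun l => l < k)).card) •
        ((X k : MvPolynomial (Fin n) K) • m (insert k L)) = 0) :
    ∃ Js : Fin (p + 1) → Finset (Fin n), Function.Injective Js ∧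
      (∀ a : Fin (p + 1), (Js a).card = p) ∧
      LinearIndependent K (fun a : Fin (p + 1) => m (Js a)) := by
  have hle := IsKoszulCycle.succ_le_finrank_span (m := m) p hcycle hcard hne
  obtain ⟨κ, a, ha, hspan, hli⟩ := exists_linearIndependent' K m
  have := Finite.of_injective a ha
  have := Fintype.ofFinite κ
  rw [← hspan, finrank_span_eq_card hli] at hle
  obtain ⟨f⟩ : Nonempty (Fin (p + 1) ↪ κ) :=
    Function.Embedding.nonempty_of_card_le (by simpa using hle)
  refine ⟨a ∘ f, ha.comp f.injective, fun i => ?_, hli.comp f f.injective⟩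
  by_contra h
  exact hli.ne_zero (f i) (hcard _ h)
end
end

section
/- Let p ∈ {1,…,j} and t ∈ ℕ. Assume H_i^l(j) = 0 for all i with p−1 ≤ i ≤ j and all l with 0 ≤ l ≤ t−1. Let z ∈ Z_p^t(j) be multihomogeneous of some multidegree a ∈ ℕ^n, with nonzero class in H_p^t(j). Then there exist a multihomogeneous cycle z̃ ∈ Z_p^t(j) with z̃ − z ∈ B_p^t(j), and indices j_1,…,j_p ∈ {1,…,j}, such that the homology classes [∂_{j_1}(z̃)],…,[∂_{j_p}(z̃)] in H_{p−1}^t(j) are K-linearly independent. -/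
open MvPolynomial

noncomputable section

/-- The Koszul differential on families of module elements indexed by finite subsets
of `Fin n`. -/
def koszulD (n : ℕ) {K : Type*} [Field K] {M : Type*} [AddCommGroup M] [Module K M]
    [Module (MvPolynomial (Fin n) K) M] [IsScalarTower K (MvPolynomial (Fin n) K) M] :
    (Finset (Fin n) → M) →ₗ[K] (Finset (Fin n) → M) where
  toFun m L := ∑ k ∈ Lᶜ, ((-1 : ℤ) ^ (L.filter (fun l => l < k)).card) •
      ((X k : MvPolynomial (Fin n) K) • m (insert k L))
  map_add' a b := by
    funext L
    simp [smul_add, Finset.sum_add_distrib]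
  map_smul' c a := by
    funext L
    simp only [Pi.smul_apply, RingHom.id_apply, Finset.smul_sum]
    refine Finset.sum_congr rfl fun k _ => ?_
    rw [smul_comm (X k : MvPolynomial (Fin n) K) c, smul_comm ((-1 : ℤ) ^ (L.filter (fun l => l < k)).card) c]

/-- The degree-`(i, i+t)` piece of the Koszul complex of `x_1, …, x_j` with values in the
graded module with graded pieces `gr`: families `(m_J)` with `m_J ∈ gr t`, supported on
`i`-element subsets of `{1, …, j}` (i.e. of `{0, …, j-1}` in `Fin n`). -/
def koszulC (n : ℕ) {K : Type*} [Field K] {M : Type*} [AddCommGroup M] [Module K M]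
    (gr : ℤ → Submodule K M) (i : ℕ) (t : ℤ) (j : ℕ) :
    Submodule K (Finset (Fin n) → M) where
  carrier := {m | ∀ J : Finset (Fin n),
    m J ∈ gr t ∧ (¬(J.card = i ∧ ∀ k ∈ J, (k : ℕ) < j) → m J = 0)}
  zero_mem' := fun J => ⟨(gr t).zero_mem, fun _ => rfl⟩
  add_mem' := by
    intro a b ha hb J
    refine ⟨(gr t).add_mem (ha J).1 (hb J).1, fun h => ?_⟩
    simp [Pi.add_apply, (ha J).2 h, (hb J).2 h]
  smul_mem' := by
    intro c a ha J
    exact ⟨(gr t).smul_mem c (ha J).1, fun h => by simp [Pi.smul_apply, (ha J).2 h]⟩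

/-- Cycles: `Z_i^t(j)`. -/
def koszulZ (n : ℕ) {K : Type*} [Field K] {M : Type*} [AddCommGroup M] [Module K M]
    [Module (MvPolynomial (Fin n) K) M] [IsScalarTower K (MvPolynomial (Fin n) K) M]
    (gr : ℤ → Submodule K M) (i : ℕ) (t : ℤ) (j : ℕ) :
    Submodule K (Finset (Fin n) → M) :=
  koszulC n gr i t j ⊓ LinearMap.ker (koszulD n)

/-- Boundaries: `B_i^t(j)`, the image of `C_{i+1}^{t-1}(j)` under the differential. -/
def koszulB (n : ℕ) {K : Type*} [Field K] {M : Type*} [AddCommGroup M] [Module K M]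
    [Module (MvPolynomial (Fin n) K) M] [IsScalarTower K (MvPolynomial (Fin n) K) M]
    (gr : ℤ → Submodule K M) (i : ℕ) (t : ℤ) (j : ℕ) :
    Submodule K (Finset (Fin n) → M) :=
  (koszulC n gr (i + 1) (t - 1) j).map (koszulD n)

/-- The contraction `∂_k`. -/
def koszulContr (n : ℕ) {M : Type*} [AddCommGroup M] (k : Fin n)
    (m : Finset (Fin n) → M) : Finset (Fin n) → M :=
  fun L => if k ∈ L then 0
    else ((-1 : ℤ) ^ (L.filter (fun l => l < k)).card) • m (insert k L)

end

/-- The `ℤ`-graded pieces of an `ℕⁿ`-graded module: `M_l = ⊕_{|a| = l} M_a`. -/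
noncomputable def totalGrading {K : Type*} [Field K] {M : Type*} [AddCommGroup M]
    [Module K M] {n : ℕ} (gr : (Fin n → ℕ) → Submodule K M) : ℤ → Submodule K M :=
  fun l => ⨆ (a : Fin n → ℕ) (_ : (∑ i, (a i : ℤ)) = l), gr a

/-- `z = (m_J)` is multihomogeneous of multidegree `a`: `m_J ∈ M_{a - ε(J)}`, with
`m_J = 0` whenever `a - ε(J)` has a negative coordinate. -/
def Multihomogeneous {K : Type*} [Field K] {M : Type*} [AddCommGroup M] [Module K M]
    {n : ℕ} (gr : (Fin n → ℕ) → Submodule K M) (a : Fin n → ℕ)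
    (z : Finset (Fin n) → M) : Prop :=
  ∀ J : Finset (Fin n),
    ((∀ i ∈ J, 1 ≤ a i) → z J ∈ gr (fun i => a i - (if i ∈ J then 1 else 0))) ∧
    (¬(∀ i ∈ J, 1 ≤ a i) → z J = 0)

section KoszulAlgebra

variable {n : ℕ} {M : Type*} [AddCommGroup M]

/-- The sign with which the `k`-th basis vector is moved past the earlier elements of `L`. -/
def koszulSign (k : Fin n) (L : Finset (Fin n)) : ℤ :=
  (-1) ^ (L.filter (fun l => l < k)).card

/-- Exterior multiplication by the `k`-th basis vector. -/
def koszulWedge (k : Fin n) (m : Finset (Fin n) → M) : Finset (Fin n) → M :=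
  fun L => if k ∈ L then koszulSign k (L.erase k) • m (L.erase k) else 0

lemma koszulSign_mul_self (k : Fin n) (L : Finset (Fin n)) :
    koszulSign k L * koszulSign k L = 1 := by
  rw [koszulSign, ← mul_pow]
  simp

lemma koszulSign_insert {k l : Fin n} {L : Finset (Fin n)} (hl : l ∉ L) :
    koszulSign k (insert l L) = if l < k then -koszulSign k L else koszulSign k L := by
  unfold koszulSign
  rw [Finset.filter_insert]
  split_ifs
  · rw [Finset.card_insert_of_notMem (by simp [hl]), pow_succ]
    ring
  · rfl

lemma koszulSign_swap {k l : Fin n} {L : Finset (Fin n)} (hkl : k ≠ l) (hk : k ∉ L) (hl : l ∉ L) :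
    koszulSign k L * koszulSign l (insert k L) = -(koszulSign l L * koszulSign k (insert l L)) := by
  rw [koszulSign_insert hk, koszulSign_insert hl]
  rcases lt_or_gt_of_ne hkl with h | h
  · rw [if_pos h, if_neg h.not_gt]
    ring
  · rw [if_neg h.not_gt, if_pos h]
    ring

lemma koszulContr_apply (k : Fin n) (m : Finset (Fin n) → M) (L : Finset (Fin n)) :
    koszulContr n k m L = if k ∈ L then 0 else koszulSign k L • m (insert k L) := rfl

lemma koszulContr_zero (k : Fin n) : koszulContr n k (0 : Finset (Fin n) → M) = 0 := by
  funext L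
  simp [koszulContr_apply]

lemma koszulContr_add (k : Fin n) (m m' : Finset (Fin n) → M) :
    koszulContr n k (m + m') = koszulContr n k m + koszulContr n k m' := by
  funext L
  simp only [koszulContr_apply, Pi.add_apply]
  split_ifs <;> simp

lemma koszulContr_sum {ι : Type*} (s : Finset ι) (k : Fin n) (m : ι → Finset (Fin n) → M) :
    koszulContr n k (∑ i ∈ s, m i) = ∑ i ∈ s, koszulContr n k (m i) :=
  map_sum (AddMonoidHom.mk' (koszulContr n k) (koszulContr_add k)) m s

lemma koszulWedge_zero (k : Fin n) : koszulWedge k (0 : Finset (Fin n) → M) = 0 := by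
  funext L
  simp [koszulWedge]

lemma koszulWedge_add (k : Fin n) (m m' : Finset (Fin n) → M) :
    koszulWedge k (m + m') = koszulWedge k m + koszulWedge k m' := by
  funext L
  simp only [koszulWedge, Pi.add_apply]
  split_ifs <;> simp

lemma koszulWedge_sum {ι : Type*} (s : Finset ι) (k : Fin n) (m : ι → Finset (Fin n) → M) :
    koszulWedge k (∑ i ∈ s, m i) = ∑ i ∈ s, koszulWedge k (m i) :=
  map_sum (AddMonoidHom.mk' (koszulWedge k) (koszulWedge_add k)) m s

lemma koszulContr_smul {R : Type*} [Semiring R] [Module R M] (k : Fin n) (r : R)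
    (m : Finset (Fin n) → M) : koszulContr n k (r • m) = r • koszulContr n k m := by
  funext L
  simp only [koszulContr_apply, Pi.smul_apply]
  split_ifs
  · simp
  · rw [smul_comm]

lemma koszulWedge_smul {R : Type*} [Semiring R] [Module R M] (k : Fin n) (r : R)
    (m : Finset (Fin n) → M) : koszulWedge k (r • m) = r • koszulWedge k m := by
  funext L
  simp only [koszulWedge, Pi.smul_apply]
  split_ifs
  · rw [smul_comm]
  · simp

lemma koszulContr_koszulContr_self (k : Fin n) (m : Finset (Fin n) → M) :
    koszulContr n k (koszulContr n k m) = 0 := by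
  funext L
  simp [koszulContr_apply]

lemma koszulContr_koszulContr (k l : Fin n) (m : Finset (Fin n) → M) :
    koszulContr n k (koszulContr n l m) = -koszulContr n l (koszulContr n k m) := by
  rcases eq_or_ne k l with rfl | hkl
  · simp [koszulContr_koszulContr_self]
  funext L
  simp only [koszulContr_apply, Pi.neg_apply, Finset.mem_insert, hkl, hkl.symm, false_or]
  by_cases hk : k ∈ L
  · simp [hk]
  by_cases hl : l ∈ L
  · simp [hl]
  simp only [hk, hl, if_false]
  rw [smul_smul, smul_smul, koszulSign_swap hkl hk hl, neg_smul, Finset.insert_comm]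

lemma koszulContr_koszulWedge_self (k : Fin n) (m : Finset (Fin n) → M) :
    koszulContr n k (koszulWedge k m) + koszulWedge k (koszulContr n k m) = m := by
  funext L
  by_cases hk : k ∈ L <;>
    simp [koszulContr_apply, koszulWedge, hk, smul_smul, koszulSign_mul_self]

lemma koszulContr_koszulWedge {k l : Fin n} (hkl : l ≠ k) (m : Finset (Fin n) → M) :
    koszulContr n l (koszulWedge k m) = -koszulWedge k (koszulContr n l m) := by
  funext L
  simp only [koszulContr_apply, koszulWedge, Pi.neg_apply, Finset.mem_insert, Finset.mem_erase,
    hkl, hkl.symm, false_or, ne_eq, not_false_eq_true, true_and]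
  by_cases hl : l ∈ L
  · simp [hl]
  by_cases hk : k ∈ L
  · simp only [hl, hk, if_true, if_false]
    obtain ⟨L, hk', rfl⟩ : ∃ L', k ∉ L' ∧ L = insert k L' :=
      ⟨L.erase k, by simp, (Finset.insert_erase hk).symm⟩
    have hl' : l ∉ L := fun h => hl (Finset.mem_insert_of_mem h)
    have h1 : (insert l (insert k L)).erase k = insert l L := by
      rw [Finset.insert_comm, Finset.erase_insert (by simp [hkl.symm, hk'])]
    rw [h1, Finset.erase_insert hk', smul_smul, smul_smul, ← neg_smul]
    congr 1
    rw [koszulSign_insert hk', koszulSign_insert hl']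
    rcases lt_or_gt_of_ne hkl with h | h <;>
    · rw [if_neg h.not_gt, if_pos h]
      ring
  · simp [hk]

end KoszulAlgebra

section KoszulDifferential

variable {n : ℕ} {K : Type*} [Field K] {M : Type*} [AddCommGroup M] [Module K M]
  [Module (MvPolynomial (Fin n) K) M] [IsScalarTower K (MvPolynomial (Fin n) K) M]

lemma koszulD_eq_sum (m : Finset (Fin n) → M) :
    koszulD n (K := K) m = ∑ k, (X k : MvPolynomial (Fin n) K) • koszulContr n k m := by
  funext L
  rw [Finset.sum_apply, ← Finset.sum_subset (Finset.subset_univ Lᶜ)]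
  · refine Finset.sum_congr rfl fun k hk => ?_
    rw [Finset.mem_compl] at hk
    rw [Pi.smul_apply, koszulContr_apply, if_neg hk, smul_comm]
    rfl
  · intro k _ hk
    rw [Finset.mem_compl, not_not] at hk
    simp [koszulContr_apply, hk]

lemma koszulD_koszulContr (k : Fin n) (m : Finset (Fin n) → M) :
    koszulD n (K := K) (koszulContr n k m) = -koszulContr n k (koszulD n (K := K) m) := by
  rw [koszulD_eq_sum, koszulD_eq_sum, koszulContr_sum, ← Finset.sum_neg_distrib]
  refine Finset.sum_congr rfl fun l _ => ?_
  rw [koszulContr_smul, koszulContr_koszulContr, smul_neg]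

lemma koszulD_koszulD (m : Finset (Fin n) → M) :
    koszulD n (K := K) (koszulD n (K := K) m) = 0 := by
  have h : koszulD n (K := K) (koszulD n (K := K) m) =
      ∑ q : Fin n × Fin n, (X q.1 * X q.2 : MvPolynomial (Fin n) K) •
        koszulContr n q.1 (koszulContr n q.2 m) := by
    rw [Fintype.sum_prod_type, koszulD_eq_sum, koszulD_eq_sum]
    refine Finset.sum_congr rfl fun k _ => ?_
    rw [koszulContr_sum, Finset.smul_sum]
    refine Finset.sum_congr rfl fun l _ => ?_
    rw [koszulContr_smul, smul_smul]
  rw [h]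
  refine Finset.sum_involution (fun q _ => q.swap) ?_ ?_ (fun _ _ => Finset.mem_univ _) (by simp)
  · rintro ⟨k, l⟩ -
    simp only [Prod.fst_swap, Prod.snd_swap]
    rw [koszulContr_koszulContr k l, mul_comm, smul_neg, neg_add_cancel]
  · rintro ⟨k, l⟩ - hne heq
    obtain rfl : l = k := congrArg Prod.fst heq
    exact hne (by simp [koszulContr_koszulContr_self])

lemma koszulD_koszulWedge (k : Fin n) (m : Finset (Fin n) → M) :
    koszulD n (K := K) (koszulWedge k m) =
      (X k : MvPolynomial (Fin n) K) • m - koszulWedge k (koszulD n (K := K) m) := by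
  rw [eq_sub_iff_add_eq, koszulD_eq_sum, koszulD_eq_sum, koszulWedge_sum,
    ← Finset.sum_add_distrib, Finset.sum_eq_single k]
  · rw [koszulWedge_smul, ← smul_add, koszulContr_koszulWedge_self]
  · intro l _ hl
    rw [koszulWedge_smul, koszulContr_koszulWedge hl, smul_neg, neg_add_cancel]
  · simp

/-- If `∂_k y` is the differential of `u`, then adding `d (e_k ∧ u)` to `y` removes `e_k`
without reintroducing any basis vector absent from both `y` and `u`. -/
lemma koszulContr_add_koszulD_koszulWedge {k : Fin n} {F : Finset (Fin n)}
    {y u : Finset (Fin n) → M} (hy : ∀ f ∈ F, koszulContr n f y = 0)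
    (hu : ∀ f ∈ insert k F, koszulContr n f u = 0)
    (hdu : koszulD n (K := K) u = koszulContr n k y) :
    ∀ f ∈ insert k F, koszulContr n f (y + koszulD n (K := K) (koszulWedge k u)) = 0 := by
  have h : y + koszulD n (K := K) (koszulWedge k u) =
      koszulContr n k (koszulWedge k y) + (X k : MvPolynomial (Fin n) K) • u := by
    rw [koszulD_koszulWedge, hdu]
    nth_rewrite 1 [← koszulContr_koszulWedge_self k y]
    abel
  intro f hf
  rw [h, koszulContr_add, koszulContr_smul, hu f hf, smul_zero, add_zero]
  rcases eq_or_ne f k with rfl | hfk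
  · exact koszulContr_koszulContr_self _ _
  · rw [koszulContr_koszulContr, koszulContr_koszulWedge hfk,
      hy f (Finset.mem_of_mem_insert_of_ne hf hfk), koszulWedge_zero, neg_zero, koszulContr_zero,
      neg_zero]

end KoszulDifferential

section KoszulGraded

variable {n : ℕ} {K : Type*} [Field K] {M : Type*} [AddCommGroup M] [Module K M]

lemma koszulContr_mem_koszulC {g : ℤ → Submodule K M} {i : ℕ} {t : ℤ} {j : ℕ} (k : Fin n)
    {m : Finset (Fin n) → M} (hm : m ∈ koszulC n g (i + 1) t j) :
    koszulContr n k m ∈ koszulC n g i t j := by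
  intro L
  rw [koszulContr_apply]
  split_ifs with hk
  · exact ⟨zero_mem _, fun _ => rfl⟩
  · refine ⟨zsmul_mem (hm _).1 _, fun h => ?_⟩
    rw [(hm (insert k L)).2, smul_zero]
    rintro ⟨h1, h2⟩
    rw [Finset.card_insert_of_notMem hk] at h1
    exact h ⟨by omega, fun l hl => h2 l (Finset.mem_insert_of_mem hl)⟩

lemma koszulWedge_mem_koszulC {g : ℤ → Submodule K M} {i : ℕ} {t : ℤ} {j : ℕ} {k : Fin n}
    (hkj : (k : ℕ) < j) {m : Finset (Fin n) → M} (hm : m ∈ koszulC n g i t j) :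
    koszulWedge k m ∈ koszulC n g (i + 1) t j := by
  intro L
  rw [koszulWedge]
  split_ifs with hk
  · refine ⟨zsmul_mem (hm _).1 _, fun h => ?_⟩
    rw [(hm (L.erase k)).2, smul_zero]
    rintro ⟨h1, h2⟩
    refine h ⟨?_, fun l hl => ?_⟩
    · rw [← h1, Finset.card_erase_add_one hk]
    · rcases eq_or_ne l k with rfl | hlk
      · exact hkj
      · exact h2 l (Finset.mem_erase.2 ⟨hlk, hl⟩)
  · exact ⟨zero_mem _, fun _ => rfl⟩

/-- A family that avoids all but fewer than `p` of the first `j` basis vectors vanishes in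
exterior degree `p`. -/
lemma eq_zero_of_koszulContr_eq_zero {g : ℤ → Submodule K M} {p : ℕ} {t : ℤ} {j : ℕ}
    {F : Finset (Fin n)} {m : Finset (Fin n) → M} (hm : m ∈ koszulC n g p t j)
    (hF : ∀ k ∈ F, koszulContr n k m = 0)
    (hcard : ((Finset.univ.filter fun k : Fin n => (k : ℕ) < j) \ F).card < p) : m = 0 := by
  funext J
  by_contra hne
  have hJ : J.card = p ∧ ∀ k ∈ J, (k : ℕ) < j := by
    by_contra h
    exact hne ((hm J).2 h)
  obtain ⟨k, hkJ, hkF⟩ : ∃ k ∈ J, k ∈ F := by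
    by_contra! h
    have hsub : J ⊆ (Finset.univ.filter fun k : Fin n => (k : ℕ) < j) \ F := fun k hk => by
      simp [hJ.2 k hk, h k hk]
    have := Finset.card_le_card hsub
    omega
  have h := congrFun (hF k hkF) (J.erase k)
  rw [koszulContr_apply, if_neg (by simp), Finset.insert_erase hkJ, Pi.zero_apply] at h
  apply hne
  rw [Pi.zero_apply, ← one_smul ℤ (m J), ← koszulSign_mul_self k (J.erase k), ← smul_smul, h,
    smul_zero]

variable [Module (MvPolynomial (Fin n) K) M] [IsScalarTower K (MvPolynomial (Fin n) K) M]

lemma koszulD_mem_koszulC {g : ℤ → Submodule K M}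
    (hX : ∀ (k : Fin n) (l : ℤ), ∀ m ∈ g l, (X k : MvPolynomial (Fin n) K) • m ∈ g (l + 1))
    {i : ℕ} {t : ℤ} {j : ℕ} {m : Finset (Fin n) → M} (hm : m ∈ koszulC n g (i + 1) t j) :
    koszulD n (K := K) m ∈ koszulC n g i (t + 1) j := by
  rw [koszulD_eq_sum]
  refine Submodule.sum_mem _ fun k _ L => ⟨hX k t _ (koszulContr_mem_koszulC k hm L).1, fun h => ?_⟩
  rw [Pi.smul_apply, (koszulContr_mem_koszulC k hm L).2 h, smul_zero]

lemma koszulContr_mem_koszulZ {g : ℤ → Submodule K M} {i : ℕ} {t : ℤ} {j : ℕ} (k : Fin n)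
    {m : Finset (Fin n) → M} (hm : m ∈ koszulC n g (i + 1) t j)
    (hd : koszulContr n k (koszulD n (K := K) m) = 0) :
    koszulContr n k m ∈ koszulZ n (K := K) g i t j :=
  ⟨koszulContr_mem_koszulC k hm, LinearMap.mem_ker.2 (by rw [koszulD_koszulContr, hd, neg_zero])⟩

/-- If the Koszul homology in exterior degree `q` vanishes in internal degrees `0, …, t - 1`, then
a chain whose differential avoids the basis vectors in `G` can be replaced by a chain avoiding
them. -/
lemma exists_koszulD_eq_of_koszulContr_koszulD_eq_zero {g : ℤ → Submodule K M}
    (hX : ∀ (k : Fin n) (l : ℤ), ∀ m ∈ g l, (X k : MvPolynomial (Fin n) K) • m ∈ g (l + 1))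
    (hneg : ∀ l < 0, g l = ⊥) {q t j : ℕ}
    (hvanish : ∀ l : ℕ, l < t → koszulZ n (K := K) g q l j ≤ koszulB n (K := K) g q l j)
    {s : ℕ} (hs : s ≤ t) {G : Finset (Fin n)} (hG : ∀ k ∈ G, (k : ℕ) < j)
    {u : Finset (Fin n) → M} (hu : u ∈ koszulC n g (q + 1) ((s : ℤ) - 1) j)
    (hdu : ∀ k ∈ G, koszulContr n k (koszulD n (K := K) u) = 0) :
    ∃ v ∈ koszulC n g (q + 1) ((s : ℤ) - 1) j, koszulD n (K := K) v = koszulD n (K := K) u ∧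
      ∀ k ∈ G, koszulContr n k v = 0 := by
  induction s generalizing G u with
  | zero =>
    have h0 : u = 0 := funext fun J => by
      have := (hu J).1
      rwa [hneg _ (by simp), Submodule.mem_bot] at this
    exact ⟨u, hu, rfl, fun k _ => by rw [h0, koszulContr_zero]⟩
  | succ s ih =>
    have hcast : ((s + 1 : ℕ) : ℤ) - 1 = s := by push_cast; ring
    rw [hcast] at hu ⊢
    induction G using Finset.induction_on with
    | empty => exact ⟨u, hu, rfl, by simp⟩
    | insert k F _ ihF =>
      obtain ⟨y, hy, hdy, hyF⟩ := ihF (fun f hf => hG f (Finset.mem_insert_of_mem hf))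
        (fun f hf => hdu f (Finset.mem_insert_of_mem hf))
      have hkj := hG k (Finset.mem_insert_self k F)
      obtain ⟨w, hw, hdw⟩ := hvanish s (by omega)
        (koszulContr_mem_koszulZ k hy (by rw [hdy]; exact hdu k (Finset.mem_insert_self k F)))
      obtain ⟨v, hv, hdv, hvF⟩ := ih (by omega) hG hw (fun f hf => by
        rw [hdw]
        rcases Finset.mem_insert.1 hf with rfl | hf
        · exact koszulContr_koszulContr_self _ _
        · rw [koszulContr_koszulContr, hyF f hf, koszulContr_zero, neg_zero])
      have hmem := koszulD_mem_koszulC hX (koszulWedge_mem_koszulC hkj hv)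
      rw [sub_add_cancel] at hmem
      exact ⟨_, add_mem hy hmem, by rw [map_add, koszulD_koszulD, add_zero, hdy],
        koszulContr_add_koszulD_koszulWedge hyF hvF (hdv.trans hdw)⟩

lemma koszulB_le_koszulZ {g : ℤ → Submodule K M}
    (hX : ∀ (k : Fin n) (l : ℤ), ∀ m ∈ g l, (X k : MvPolynomial (Fin n) K) • m ∈ g (l + 1))
    (i : ℕ) (t : ℤ) (j : ℕ) : koszulB n (K := K) g i t j ≤ koszulZ n (K := K) g i t j := by
  rintro _ ⟨u, hu, rfl⟩
  have h := koszulD_mem_koszulC hX hu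
  rw [sub_add_cancel] at h
  exact ⟨h, koszulD_koszulD u⟩

/-- A cycle avoiding `F` whose contraction along `k` is a boundary is homologous to a cycle avoiding
`insert k F`. -/
lemma exists_sub_mem_koszulB_of_koszulContr_mem_koszulB {g : ℤ → Submodule K M}
    (hX : ∀ (k : Fin n) (l : ℤ), ∀ m ∈ g l, (X k : MvPolynomial (Fin n) K) • m ∈ g (l + 1))
    (hneg : ∀ l < 0, g l = ⊥) {q t j : ℕ}
    (hvanish : ∀ l : ℕ, l < t → koszulZ n (K := K) g q l j ≤ koszulB n (K := K) g q l j)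
    {k : Fin n} (hkj : (k : ℕ) < j) {F : Finset (Fin n)} (hF : ∀ f ∈ F, (f : ℕ) < j)
    {y : Finset (Fin n) → M} (hyF : ∀ f ∈ F, koszulContr n f y = 0)
    (hk : koszulContr n k y ∈ koszulB n (K := K) g q t j) :
    ∃ y', y' - y ∈ koszulB n (K := K) g (q + 1) t j ∧
      ∀ f ∈ insert k F, koszulContr n f y' = 0 := by
  obtain ⟨w, hw, hdw⟩ := hk
  obtain ⟨v, hv, hdv, hvF⟩ := exists_koszulD_eq_of_koszulContr_koszulD_eq_zero hX hneg hvanish le_rfl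
    (G := insert k F) (by simpa [hkj] using hF) hw (fun f hf => by
      rw [hdw]
      rcases Finset.mem_insert.1 hf with rfl | hf
      · exact koszulContr_koszulContr_self _ _
      · rw [koszulContr_koszulContr, hyF f hf, koszulContr_zero, neg_zero])
  refine ⟨_, ?_, koszulContr_add_koszulD_koszulWedge hyF hvF (hdv.trans hdw)⟩
  rw [add_sub_cancel_left]
  exact Submodule.mem_map_of_mem (koszulWedge_mem_koszulC hkj hv)

end KoszulGraded

section Multigraded

variable {n : ℕ} {K : Type*} [Field K] {M : Type*} [AddCommGroup M] [Module K M]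

lemma totalGrading_eq_bot_of_neg (gr : (Fin n → ℕ) → Submodule K M) {l : ℤ} (hl : l < 0) :
    totalGrading gr l = ⊥ := by
  simp only [totalGrading, iSup_eq_bot]
  rintro a rfl
  exact absurd hl (not_lt.2 (Finset.sum_nonneg fun i _ => Int.natCast_nonneg _))

lemma totalGrading_le_iff {gr : (Fin n → ℕ) → Submodule K M} {l : ℤ} {N : Submodule K M} :
    totalGrading gr l ≤ N ↔ ∀ a : Fin n → ℕ, ∑ i, (a i : ℤ) = l → gr a ≤ N := by
  simp only [totalGrading, iSup_le_iff]

lemma le_totalGrading {gr : (Fin n → ℕ) → Submodule K M} {l : ℤ} {a : Fin n → ℕ}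
    (ha : ∑ i, (a i : ℤ) = l) : gr a ≤ totalGrading gr l :=
  totalGrading_le_iff.1 le_rfl a ha

/-- `pr c` is the projection onto the graded piece of degree `c`, which is zero if `c` has a
negative coordinate. -/
def IsGradedProj (gr : (Fin n → ℕ) → Submodule K M) (pr : (Fin n → ℤ) → M →ₗ[K] M) : Prop :=
  ∀ b, ∀ m ∈ gr b, ∀ c, pr c m = if c = (fun i => (b i : ℤ)) then m else 0

lemma exists_isGradedProj {gr : (Fin n → ℕ) → Submodule K M} (h : DirectSum.IsInternal gr) :
    ∃ pr, IsGradedProj gr pr := by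
  classical
  let _ := h.chooseDecomposition
  refine ⟨fun c => if ∀ i, 0 ≤ c i then
    (gr fun i => (c i).toNat).subtype ∘ₗ DirectSum.component K _ _ _ ∘ₗ
      (DirectSum.decomposeLinearEquiv gr).toLinearMap else 0, fun b m hm c => ?_⟩
  by_cases hc : ∀ i, 0 ≤ c i
  · obtain ⟨c, rfl⟩ : ∃ c' : Fin n → ℕ, c = fun i => (c' i : ℤ) :=
      ⟨fun i => (c i).toNat, funext fun i => (Int.toNat_of_nonneg (hc i)).symm⟩
    have hiff : ((fun i => (c i : ℤ)) = fun i => (b i : ℤ)) ↔ b = c := by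
      simp [funext_iff, eq_comm]
    simp only [hc, implies_true, if_true, hiff, Int.toNat_natCast, LinearMap.comp_apply,
      Submodule.subtype_apply]
    change ((DirectSum.decompose gr m) c : M) = _
    split_ifs with hbc
    · subst hbc
      exact DirectSum.decompose_of_mem_same gr hm
    · exact DirectSum.decompose_of_mem_ne gr hm hbc
  · have hcb : c ≠ fun i => (b i : ℤ) := by
      rintro rfl
      exact hc fun i => Int.natCast_nonneg _
    simp only [hc, hcb, if_false, LinearMap.zero_apply]

variable {gr : (Fin n → ℕ) → Submodule K M} {pr : (Fin n → ℤ) → M →ₗ[K] M}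

lemma IsGradedProj.mem (hpr : IsGradedProj gr pr) (htop : iSup gr = ⊤) (c : Fin n → ℕ) (m : M) :
    pr (fun i => (c i : ℤ)) m ∈ gr c := by
  have h : iSup gr ≤ (gr c).comap (pr fun i => (c i : ℤ)) := iSup_le fun b m hm => by
    rw [Submodule.mem_comap, hpr b m hm]
    split_ifs with hc
    · have : c = b := funext fun i => Int.natCast_inj.1 (congrFun hc i)
      rwa [this]
    · exact zero_mem _
  exact h (htop ▸ Submodule.mem_top)

lemma IsGradedProj.eq_zero (hpr : IsGradedProj gr pr) (htop : iSup gr = ⊤) {c : Fin n → ℤ}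
    (hc : ∃ i, c i < 0) (m : M) : pr c m = 0 := by
  have h : iSup gr ≤ LinearMap.ker (pr c) := iSup_le fun b m hm => by
    rw [LinearMap.mem_ker, hpr b m hm, if_neg]
    rintro rfl
    obtain ⟨i, hi⟩ := hc
    exact hi.not_ge (Int.natCast_nonneg _)
  exact h (htop ▸ Submodule.mem_top)

lemma IsGradedProj.mem_totalGrading (hpr : IsGradedProj gr pr) (c : Fin n → ℤ) {l : ℤ} {m : M}
    (hm : m ∈ totalGrading gr l) : pr c m ∈ totalGrading gr l := by
  have h : totalGrading gr l ≤ (totalGrading gr l).comap (pr c) :=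
    totalGrading_le_iff.2 fun b hb m hm => by
      rw [Submodule.mem_comap, hpr b m hm]
      split_ifs
      · exact le_totalGrading hb hm
      · exact zero_mem _
  exact h hm

/-- The projection of a family onto its component of multidegree `c`. -/
def multidegreeProj (pr : (Fin n → ℤ) → M →ₗ[K] M) (c : Fin n → ℤ) :
    (Finset (Fin n) → M) →ₗ[K] (Finset (Fin n) → M) :=
  LinearMap.pi fun J => pr (fun i => c i - if i ∈ J then 1 else 0) ∘ₗ LinearMap.proj J

lemma multidegreeProj_apply (pr : (Fin n → ℤ) → M →ₗ[K] M) (c : Fin n → ℤ)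
    (m : Finset (Fin n) → M) (J : Finset (Fin n)) :
    multidegreeProj pr c m J = pr (fun i => c i - if i ∈ J then 1 else 0) (m J) := rfl

lemma multidegreeProj_mem_koszulC (hpr : IsGradedProj gr pr) (c : Fin n → ℤ) {i : ℕ} {t : ℤ}
    {j : ℕ} {m : Finset (Fin n) → M} (hm : m ∈ koszulC n (totalGrading gr) i t j) :
    multidegreeProj pr c m ∈ koszulC n (totalGrading gr) i t j := fun J =>
  ⟨hpr.mem_totalGrading _ (hm J).1, fun h => by rw [multidegreeProj_apply, (hm J).2 h, map_zero]⟩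

lemma koszulContr_multidegreeProj (pr : (Fin n → ℤ) → M →ₗ[K] M) (c : Fin n → ℤ) (k : Fin n)
    (m : Finset (Fin n) → M) :
    koszulContr n k (multidegreeProj pr c m) =
      multidegreeProj pr (c - Pi.single k 1) (koszulContr n k m) := by
  funext L
  rw [multidegreeProj_apply, koszulContr_apply, koszulContr_apply]
  split_ifs with hk
  · simp
  · rw [map_zsmul, multidegreeProj_apply]
    congr 3
    funext i
    rcases eq_or_ne i k with rfl | hik
    · simp [hk]
    · simp [hik]

lemma multidegreeProj_multihomogeneous (hpr : IsGradedProj gr pr) (htop : iSup gr = ⊤)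
    (a : Fin n → ℕ) (m : Finset (Fin n) → M) :
    Multihomogeneous gr a (multidegreeProj pr (fun i => (a i : ℤ)) m) := by
  intro J
  rw [multidegreeProj_apply]
  refine ⟨fun h => ?_, fun h => ?_⟩
  · convert hpr.mem htop _ (m J) using 3
    funext i
    split_ifs with hi
    · have := h i hi
      omega
    · simp
  · push Not at h
    obtain ⟨i, hi, hai⟩ := h
    exact hpr.eq_zero htop ⟨i, by simp only [hi, if_true]; omega⟩ _

lemma multidegreeProj_eq_of_multihomogeneous (hpr : IsGradedProj gr pr) {a : Fin n → ℕ}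
    {m : Finset (Fin n) → M} (hm : Multihomogeneous gr a m) (c : Fin n → ℤ) :
    multidegreeProj pr c m = if c = (fun i => (a i : ℤ)) then m else 0 := by
  funext J
  rw [multidegreeProj_apply]
  by_cases hJ : ∀ i ∈ J, 1 ≤ a i
  · have hiff : ((fun i => c i - if i ∈ J then (1 : ℤ) else 0) =
        fun i => ((a i - if i ∈ J then 1 else 0 : ℕ) : ℤ)) ↔ c = fun i => (a i : ℤ) := by
      rw [funext_iff, funext_iff]
      refine forall_congr' fun i => ?_
      split_ifs with hi
      · have := hJ i hi
        omega
      · simp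
    rw [hpr _ _ ((hm J).1 hJ)]
    simp only [hiff]
    split_ifs <;> rfl
  · rw [(hm J).2 hJ, map_zero]
    split_ifs
    · exact ((hm J).2 hJ).symm
    · rfl

/-- The contractions of a multihomogeneous family along distinct indices have distinct
multidegrees. -/
lemma multidegreeProj_koszulContr (hpr : IsGradedProj gr pr) {a : Fin n → ℕ}
    {m : Finset (Fin n) → M} (hm : Multihomogeneous gr a m) (k l : Fin n) :
    multidegreeProj pr ((fun i => (a i : ℤ)) - Pi.single k 1) (koszulContr n l m) =
      if l = k then koszulContr n l m else 0 := by
  have hl : ((fun i => (a i : ℤ)) - Pi.single k 1) =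
      ((fun i => (a i : ℤ)) - Pi.single k 1 + Pi.single l 1) - Pi.single l 1 := by simp
  rw [hl, ← koszulContr_multidegreeProj, multidegreeProj_eq_of_multihomogeneous hpr hm]
  by_cases hlk : l = k
  · simp [hlk]
  · rw [if_neg, if_neg hlk, koszulContr_zero]
    intro h
    have := congrFun h k
    simp [Ne.symm hlk] at this

variable [Module (MvPolynomial (Fin n) K) M] [IsScalarTower K (MvPolynomial (Fin n) K) M]

lemma X_smul_mem_totalGrading
    (hcompat : ∀ (i : Fin n) (b : Fin n → ℕ), ∀ m ∈ gr b,
      (X i : MvPolynomial (Fin n) K) • m ∈ gr (b + Pi.single i 1))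
    (k : Fin n) (l : ℤ) (m : M) (hm : m ∈ totalGrading gr l) :
    (X k : MvPolynomial (Fin n) K) • m ∈ totalGrading gr (l + 1) := by
  have h : totalGrading gr l ≤ (totalGrading gr (l + 1)).comap
      (Algebra.lsmul K K M (X k : MvPolynomial (Fin n) K)) :=
    totalGrading_le_iff.2 fun b hb m hm => by
      refine le_totalGrading ?_ (hcompat k b m hm)
      simp [Finset.sum_add_distrib, hb, Pi.single_apply]
  exact h hm

lemma IsGradedProj.X_smul (hpr : IsGradedProj gr pr) (htop : iSup gr = ⊤)
    (hcompat : ∀ (i : Fin n) (b : Fin n → ℕ), ∀ m ∈ gr b,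
      (X i : MvPolynomial (Fin n) K) • m ∈ gr (b + Pi.single i 1))
    (k : Fin n) (c : Fin n → ℤ) (m : M) :
    pr c ((X k : MvPolynomial (Fin n) K) • m) =
      (X k : MvPolynomial (Fin n) K) • pr (c - Pi.single k 1) m := by
  set x := Algebra.lsmul K K M (X k : MvPolynomial (Fin n) K)
  have h : iSup gr ≤ LinearMap.eqLocus (pr c ∘ₗ x) (x ∘ₗ pr (c - Pi.single k 1)) :=
    iSup_le fun b m hm => by
      change pr c ((X k : MvPolynomial (Fin n) K) • m) =
        (X k : MvPolynomial (Fin n) K) • pr (c - Pi.single k 1) m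
      have hiff : (c = fun i => ((b + Pi.single k 1 : Fin n → ℕ) i : ℤ)) ↔
          c - Pi.single k 1 = fun i => (b i : ℤ) := by
        rw [funext_iff, funext_iff]
        refine forall_congr' fun i => ?_
        rcases eq_or_ne i k with rfl | hik
        · simp [sub_eq_iff_eq_add]
        · simp [hik]
      rw [hpr _ _ (hcompat k b m hm), hpr _ _ hm]
      simp only [hiff]
      split_ifs <;> simp
  exact h (htop ▸ Submodule.mem_top)

lemma koszulD_multidegreeProj (hpr : IsGradedProj gr pr) (htop : iSup gr = ⊤)
    (hcompat : ∀ (i : Fin n) (b : Fin n → ℕ), ∀ m ∈ gr b,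
      (X i : MvPolynomial (Fin n) K) • m ∈ gr (b + Pi.single i 1))
    (c : Fin n → ℤ) (m : Finset (Fin n) → M) :
    koszulD n (K := K) (multidegreeProj pr c m) =
      multidegreeProj pr c (koszulD n (K := K) m) := by
  rw [koszulD_eq_sum, koszulD_eq_sum, map_sum]
  refine Finset.sum_congr rfl fun k _ => ?_
  rw [koszulContr_multidegreeProj]
  funext L
  rw [Pi.smul_apply, multidegreeProj_apply, multidegreeProj_apply, Pi.smul_apply,
    hpr.X_smul htop hcompat]
  congr 3
  funext i
  simp only [Pi.sub_apply]
  ring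

lemma multidegreeProj_mem_koszulB (hpr : IsGradedProj gr pr) (htop : iSup gr = ⊤)
    (hcompat : ∀ (i : Fin n) (b : Fin n → ℕ), ∀ m ∈ gr b,
      (X i : MvPolynomial (Fin n) K) • m ∈ gr (b + Pi.single i 1))
    (c : Fin n → ℤ) {i : ℕ} {t : ℤ} {j : ℕ} {m : Finset (Fin n) → M}
    (hm : m ∈ koszulB n (K := K) (totalGrading gr) i t j) :
    multidegreeProj pr c m ∈ koszulB n (K := K) (totalGrading gr) i t j := by
  obtain ⟨u, hu, rfl⟩ := hm
  rw [← koszulD_multidegreeProj hpr htop hcompat]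
  exact Submodule.mem_map_of_mem (multidegreeProj_mem_koszulC hpr c hu)

end Multigraded

open MvPolynomial in
/-- Lemma 3.1: for an `ℕⁿ`-graded module, a multihomogeneous cycle
`z ∈ Z_p^t(j)` with nonzero homology class can be corrected by a boundary to a
multihomogeneous cycle `z̃` admitting contractions `∂_{j_1}(z̃), …, ∂_{j_p}(z̃)` whose
classes in `H_{p-1}^t(j)` are `K`-linearly independent. -/
theorem multigraded_cycle_contractions {K : Type*} [Field K] {n : ℕ}
    {M : Type*} [AddCommGroup M] [Module K M]
    [Module (MvPolynomial (Fin n) K) M] [IsScalarTower K (MvPolynomial (Fin n) K) M]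
    (gr : (Fin n → ℕ) → Submodule K M)
    (hdecomp : DirectSum.IsInternal gr)
    (hcompat : ∀ (i : Fin n) (b : Fin n → ℕ), ∀ m ∈ gr b,
      (X i : MvPolynomial (Fin n) K) • m ∈ gr (b + Pi.single i 1))
    (p : ℕ) (t : ℕ) (j : ℕ) (hp1 : 1 ≤ p) (hpj : p ≤ j) (hjn : j ≤ n)
    (hvanish : ∀ i : ℕ, p - 1 ≤ i → i ≤ j → ∀ l : ℕ, l < t →
      koszulZ n (totalGrading gr) i (l : ℤ) j ≤ koszulB n (totalGrading gr) i (l : ℤ) j)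
    (a : Fin n → ℕ) (z : Finset (Fin n) → M)
    (hz : z ∈ koszulZ n (totalGrading gr) p (t : ℤ) j)
    (hzmulti : Multihomogeneous gr a z)
    (hzne : z ∉ koszulB n (totalGrading gr) p (t : ℤ) j) :
    ∃ ztil : Finset (Fin n) → M,
      ztil ∈ koszulZ n (totalGrading gr) p (t : ℤ) j ∧
      Multihomogeneous gr a ztil ∧
      ztil - z ∈ koszulB n (totalGrading gr) p (t : ℤ) j ∧
      ∃ js : Fin p → Fin n, (∀ i : Fin p, (js i : ℕ) < j) ∧
        (∀ i : Fin p, koszulContr n (js i) ztil ∈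
          koszulZ n (totalGrading gr) (p - 1) (t : ℤ) j) ∧
        (∀ c : Fin p → K,
          (∑ i, c i • koszulContr n (js i) ztil) ∈
            koszulB n (totalGrading gr) (p - 1) (t : ℤ) j →
          ∀ i, c i = 0) := by
  obtain ⟨q, rfl⟩ : ∃ q, p = q + 1 := ⟨p - 1, by omega⟩
  rw [Nat.add_sub_cancel] at *
  have hX := X_smul_mem_totalGrading (K := K) hcompat
  have htop := hdecomp.submodule_iSup_eq_top
  obtain ⟨pr, hpr⟩ := exists_isGradedProj hdecomp
  have hneg : ∀ l < 0, totalGrading gr l = ⊥ := fun l hl => totalGrading_eq_bot_of_neg gr hl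
  have hvan : ∀ l : ℕ, l < t → koszulZ n (K := K) (totalGrading gr) q l j ≤
      koszulB n (K := K) (totalGrading gr) q l j := hvanish q le_rfl (by omega)
  let P : Finset (Fin n) → Prop := fun F => (∀ f ∈ F, (f : ℕ) < j) ∧
    ∃ y, y - z ∈ koszulB n (K := K) (totalGrading gr) (q + 1) t j ∧ ∀ f ∈ F, koszulContr n f y = 0
  obtain ⟨F, ⟨hFj, y, hyB, hyF⟩, hmax⟩ := (Set.toFinite {F | P F}).exists_maximal
    ⟨∅, by simp, z, by simp, by simp⟩
  set c : Fin n → ℤ := fun i => (a i : ℤ)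
  set w := multidegreeProj pr c y with hw
  have hwB : w - z ∈ koszulB n (K := K) (totalGrading gr) (q + 1) t j := by
    have h := multidegreeProj_mem_koszulB hpr htop hcompat c hyB
    rwa [map_sub, multidegreeProj_eq_of_multihomogeneous hpr hzmulti c, if_pos rfl] at h
  have hwF : ∀ f ∈ F, koszulContr n f w = 0 := fun f hf => by
    rw [hw, koszulContr_multidegreeProj, hyF f hf, map_zero]
  have hwZ : w ∈ koszulZ n (K := K) (totalGrading gr) (q + 1) t j :=
    (Submodule.sub_mem_iff_left _ hz).1 (koszulB_le_koszulZ hX _ _ _ hwB)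
  have hwmulti : Multihomogeneous gr a w := multidegreeProj_multihomogeneous hpr htop a y
  have hnotB : ∀ k : Fin n, (k : ℕ) < j → k ∉ F →
      koszulContr n k w ∉ koszulB n (K := K) (totalGrading gr) q t j := fun k hkj hkF hB => by
    obtain ⟨y', hy'B, hy'F⟩ :=
      exists_sub_mem_koszulB_of_koszulContr_mem_koszulB hX hneg hvan hkj hFj hwF hB
    have hP : P (insert k F) := ⟨by simpa [hkj] using hFj, y', by
      simpa using add_mem hy'B hwB, hy'F⟩
    exact hkF (hmax hP (Finset.subset_insert k F) (Finset.mem_insert_self k F))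
  have hcard : q + 1 ≤ ((Finset.univ.filter fun k : Fin n => (k : ℕ) < j) \ F).card := by
    by_contra! h
    refine hzne ?_
    have hw0 := eq_zero_of_koszulContr_eq_zero hwZ.1 hwF h
    rw [hw0, zero_sub] at hwB
    exact neg_mem_iff.1 hwB
  obtain ⟨T, hTsub, hTcard⟩ := Finset.exists_subset_card_eq hcard
  let js := T.orderEmbOfFin hTcard
  have hjs : ∀ i, (js i : ℕ) < j ∧ js i ∉ F := fun i => by
    simpa using hTsub (T.orderEmbOfFin_mem hTcard i)
  refine ⟨w, hwZ, hwmulti, hwB, js, fun i => (hjs i).1, fun i =>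
    koszulContr_mem_koszulZ _ hwZ.1 (by rw [LinearMap.mem_ker.1 hwZ.2, koszulContr_zero]), ?_⟩
  intro b hb i
  by_contra hbi
  refine hnotB (js i) (hjs i).1 (hjs i).2 ((Submodule.smul_mem_iff _ hbi).1 ?_)
  have h := multidegreeProj_mem_koszulB hpr htop hcompat (c - Pi.single (js i) 1) hb
  rw [map_sum, Finset.sum_eq_single i] at h
  · rwa [map_smul, multidegreeProj_koszulContr hpr hwmulti, if_pos rfl] at h
  · intro i' _ hi'
    rw [map_smul, multidegreeProj_koszulContr hpr hwmulti, if_neg (js.injective.ne hi'), smul_zero]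
  · simp
end

section
/- Let X be a set and p ≥ 1 an integer. Suppose W_0, W_1, …, W_p are finite collections of finite subsets of X such that W_0 = {∅}, and for each i ∈ {1,…,p} there is a function assigning to each w ∈ W_{i−1} a finite set S(i,w) ⊆ X with |S(i,w)| = p − i + 1 and S(i,w) ∩ w = ∅, such that W_i = { w ∪ {s} : w ∈ W_{i−1}, s ∈ S(i,w) }. Then |W_i| ≥ binom(p,i) for every i ∈ {0,…,p}. -/
/-- Local LYM-type double counting: if every `k`-set in `A` has at least `m` one-point extensions
in the family `B` of `(k + 1)`-sets, then `|A| * m ≤ |B| * (k + 1)`. -/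
theorem Finset.card_mul_le_card_mul_of_insert_mem {X : Type*} [DecidableEq X]
    {A B : Finset (Finset X)} {S : Finset X → Finset X} {k m : ℕ}
    (hA : ∀ w ∈ A, w.card = k) (hB : ∀ w ∈ B, w.card = k + 1)
    (hS : ∀ w ∈ A, m ≤ (S w).card) (hdisj : ∀ w ∈ A, Disjoint (S w) w)
    (hins : ∀ w ∈ A, ∀ s ∈ S w, insert s w ∈ B) :
    A.card * m ≤ B.card * (k + 1) := by
  refine Finset.card_mul_le_card_mul (fun w v : Finset X => w ⊆ v) ?_ ?_
  · intro w hw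
    have hinj : Set.InjOn (fun s => insert s w) (S w : Set X) := by
      intro s hs t _ hst
      have hsw : s ∉ w := Finset.disjoint_left.1 (hdisj w hw) hs
      exact (Finset.insert_inj hsw).1 hst
    refine ((hS w hw).trans_eq (Finset.card_image_of_injOn hinj).symm).trans
      (Finset.card_le_card ?_)
    intro v hv
    obtain ⟨s, hs, rfl⟩ := Finset.mem_image.1 hv
    exact (Finset.mem_bipartiteAbove _).2 ⟨hins w hw s hs, Finset.subset_insert s w⟩
  · intro v hv
    have hsub : Finset.bipartiteBelow (fun w v : Finset X => w ⊆ v) A v ⊆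
        v.powersetCard k := by
      intro w hw
      obtain ⟨hwA, hwv⟩ := (Finset.mem_bipartiteBelow _).1 hw
      exact Finset.mem_powersetCard.2 ⟨hwv, hA w hwA⟩
    refine (Finset.card_le_card hsub).trans_eq ?_
    rw [Finset.card_powersetCard, hB v hv, Nat.choose_succ_self_right]

/-- Lemma 3.2: if `W_0 = {∅}` and each `W_i` is obtained from
`W_{i-1}` by adjoining, to each `w ∈ W_{i-1}`, one of `p - i + 1` prescribed new
elements, then `|W_i| ≥ C(p, i)` for `i = 0, …, p`. -/
theorem growing_families_card_lower_bound {X : Type*} [DecidableEq X]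
    (p : ℕ) (hp : 1 ≤ p)
    (W : ℕ → Finset (Finset X)) (Sf : ℕ → Finset X → Finset X)
    (hW0 : W 0 = {∅})
    (hSf : ∀ i : ℕ, 1 ≤ i → i ≤ p → ∀ w ∈ W (i - 1),
      (Sf i w).card = p - i + 1 ∧ Disjoint (Sf i w) w)
    (hWi : ∀ i : ℕ, 1 ≤ i → i ≤ p →
      W i = (W (i - 1)).biUnion fun w => (Sf i w).image fun s => insert s w) :
    ∀ i : ℕ, i ≤ p → Nat.choose p i ≤ (W i).card := by
  have hcard : ∀ i ≤ p, ∀ w ∈ W i, w.card = i := by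
    intro i
    induction i with
    | zero => simp [hW0]
    | succ i ih =>
      intro hi v hv
      simp only [hWi (i + 1) (by omega) hi, Nat.add_sub_cancel, Finset.mem_biUnion,
        Finset.mem_image] at hv
      obtain ⟨w, hw, s, hs, rfl⟩ := hv
      have hsw : s ∉ w :=
        Finset.disjoint_left.1 (hSf (i + 1) (by omega) hi w hw).2 hs
      rw [Finset.card_insert_of_notMem hsw, ih (by omega) w hw]
  intro i
  induction i with
  | zero => simp [hW0]
  | succ i ih =>
    intro hi
    have hstep : (W i).card * (p - i) ≤ (W (i + 1)).card * (i + 1) := by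
      refine Finset.card_mul_le_card_mul_of_insert_mem (S := Sf (i + 1))
        (hcard i (by omega)) (hcard (i + 1) hi) ?_ ?_ ?_
      · intro w hw
        have := (hSf (i + 1) (by omega) hi w hw).1
        omega
      · exact fun w hw => (hSf (i + 1) (by omega) hi w hw).2
      · intro w hw s hs
        rw [hWi (i + 1) (by omega) hi]
        exact Finset.mem_biUnion.2 ⟨w, hw, Finset.mem_image_of_mem _ hs⟩
    refine Nat.le_of_mul_le_mul_right ?_ (Nat.succ_pos i)
    calc p.choose (i + 1) * (i + 1) = p.choose i * (p - i) := Nat.choose_succ_right_eq p i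
      _ ≤ (W i).card * (p - i) := Nat.mul_le_mul_right _ (ih (by omega))
      _ ≤ (W (i + 1)).card * (i + 1) := hstep
end

section
/- Let G ⊆ Mon(n,d) be stable with |G| = k. Then for every i ∈ ℕ: Σ_{a∈G} binom(m(a)−1, i) ≥ Σ_{a∈R(d,k)} binom(m(a)−1, i). (Via the Eliahou–Kervaire formula this says: every stable monomial ideal generated in degree d with k generators has graded Betti numbers β_{i,i+d} at least those of the revlex-segment ideal I(d,k).) -/
/-- For a monomial exponent vector `a` (0-based indexing), `maxIdx a` is the largest
index `i` with `a i ≠ 0`; it equals `m(x^a) - 1` in the 1-based notation of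
Eliahou–Kervaire. -/
def maxIdx {n : ℕ} (a : Fin n → ℕ) : ℕ :=
  (Finset.univ.filter fun i : Fin n => a i ≠ 0).sup fun i => (i : ℕ)

/-- The monomial `x_i · x^a / x_{m(x^a)}` as an exponent vector. -/
def moveDown {n : ℕ} (a : Fin n → ℕ) (i : Fin n) : Fin n → ℕ :=
  fun j => a j + (if j = i then 1 else 0) - (if (j : ℕ) = maxIdx a then 1 else 0)

/-- A set of degree-`d` monomials is stable if for every `a ∈ G` and `i < m(x^a)` the
monomial `x_i · x^a / x_{m(x^a)}` belongs to `G`. -/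
def IsStableSet {n : ℕ} (G : Finset (Fin n → ℕ)) : Prop :=
  ∀ a ∈ G, ∀ i : Fin n, (i : ℕ) < maxIdx a → moveDown a i ∈ G

/-- The reverse lexicographic order: `a >_rlex b` iff `a r < b r` at the largest index
`r` where `a` and `b` differ. -/
def rlexGT {n : ℕ} (a b : Fin n → ℕ) : Prop :=
  ∃ r : Fin n, a r < b r ∧ ∀ s : Fin n, r < s → a s = b s

/-- The lexicographic order: `a >_lex b` iff `a r > b r` at the smallest index `r`
where `a` and `b` differ. -/
def lexGT {n : ℕ} (a b : Fin n → ℕ) : Prop :=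
  ∃ r : Fin n, b r < a r ∧ ∀ s : Fin n, s < r → a s = b s

theorem le_maxIdx {n : ℕ} {a : Fin n → ℕ} {i : Fin n} (h : a i ≠ 0) : (i : ℕ) ≤ maxIdx a :=
  Finset.le_sup (f := fun i : Fin n => (i : ℕ)) (by simpa using h)

theorem eq_zero_of_maxIdx_lt {n : ℕ} {a : Fin n → ℕ} {i : Fin n} (h : maxIdx a < i) : a i = 0 := by
  by_contra h0
  exact absurd (le_maxIdx h0) (by omega)

theorem exists_eq_maxIdx {n : ℕ} {a : Fin n → ℕ} (h : 0 < maxIdx a) :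
    ∃ r : Fin n, a r ≠ 0 ∧ (r : ℕ) = maxIdx a := by
  have hne : (Finset.univ.filter fun i : Fin n => a i ≠ 0).Nonempty := by
    rw [Finset.nonempty_iff_ne_empty]
    intro h0
    simp [maxIdx, h0] at h
  obtain ⟨r, hr, hr'⟩ := Finset.exists_mem_eq_sup _ hne fun i : Fin n => (i : ℕ)
  exact ⟨r, (Finset.mem_filter.1 hr).2, hr'.symm⟩

/-- A monomial in fewer variables is larger in the reverse lexicographic order. -/
theorem rlexGT_of_maxIdx_lt {n : ℕ} {a b : Fin n → ℕ} (h : maxIdx b < maxIdx a) : rlexGT b a := by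
  obtain ⟨r, hr0, hr⟩ := exists_eq_maxIdx (a := a) (by omega)
  refine ⟨r, ?_, fun s hs => ?_⟩
  · rw [eq_zero_of_maxIdx_lt (a := b) (by omega)]
    exact Nat.pos_of_ne_zero hr0
  · have hs' : (r : ℕ) < s := hs
    rw [eq_zero_of_maxIdx_lt (a := b) (by omega), eq_zero_of_maxIdx_lt (a := a) (by omega)]

/-- If two finite sets have the same size and every value of `f` on `s \ t` is at most every
value of `f` on `t \ s`, then the sum of `f` over `s` is at most the sum over `t`. -/
theorem sum_le_sum_of_forall_sdiff_le {α : Type*} [DecidableEq α] {s t : Finset α} {f : α → ℕ}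
    (hcard : s.card = t.card) (h : ∀ a ∈ s \ t, ∀ b ∈ t \ s, f a ≤ f b) :
    ∑ a ∈ s, f a ≤ ∑ a ∈ t, f a := by
  have hsd : (s \ t).card = (t \ s).card := Finset.card_sdiff_comm hcard
  have key : ∑ a ∈ s \ t, f a ≤ ∑ a ∈ t \ s, f a := by
    rcases (t \ s).eq_empty_or_nonempty with h0 | hne
    · rw [h0, Finset.card_empty, Finset.card_eq_zero] at hsd
      simp [hsd]
    · obtain ⟨b, hb, hmin⟩ := Finset.exists_min_image _ f hne
      calc ∑ a ∈ s \ t, f a ≤ (s \ t).card • f b :=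
            Finset.sum_le_card_nsmul _ _ _ fun a ha => h a ha b hb
        _ = (t \ s).card • f b := by rw [hsd]
        _ ≤ ∑ a ∈ t \ s, f a := Finset.card_nsmul_le_sum _ _ _ hmin
  rw [← Finset.sum_inter_add_sum_sdiff s t f, ← Finset.sum_inter_add_sum_sdiff t s f,
    Finset.inter_comm t s]
  exact Nat.add_le_add_left key _

/-- Proposition 4.1: a stable set `G` of `k` monomials of degree `d`
satisfies `Σ_{a ∈ G} C(m(a)-1, i) ≥ Σ_{a ∈ R} C(m(a)-1, i)` where `R` is the revlex
segment of length `k` in degree `d` (characterized as a `>_rlex`-upward-closed subset of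
the degree-`d` monomials of cardinality `k`); via the Eliahou–Kervaire formula this
bounds the Betti numbers of a stable ideal below by those of `I(d,k)`. -/
theorem stable_betti_ge_revlex_segment {n : ℕ} (hn : 1 ≤ n) (d : ℕ) (hd : 1 ≤ d) (k : ℕ)
    (G : Finset (Fin n → ℕ)) (hGdeg : ∀ a ∈ G, ∑ i, a i = d)
    (hGstable : IsStableSet G) (hGcard : G.card = k)
    (R : Finset (Fin n → ℕ)) (hRdeg : ∀ a ∈ R, ∑ i, a i = d)
    (hRseg : ∀ a ∈ R, ∀ b : Fin n → ℕ, (∑ i, b i) = d → rlexGT b a → b ∈ R)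
    (hRcard : R.card = k) :
    ∀ i : ℕ, (∑ a ∈ R, Nat.choose (maxIdx a) i) ≤ ∑ a ∈ G, Nat.choose (maxIdx a) i := by
  classical
  intro i
  refine sum_le_sum_of_forall_sdiff_le (hRcard.trans hGcard.symm) fun a ha b hb => ?_
  rw [Finset.mem_sdiff] at ha hb
  refine Nat.choose_le_choose i (not_lt.1 fun hlt => hb.2 ?_)
  exact hRseg a ha.1 b (hGdeg b hb.1) (rlexGT_of_maxIdx_lt hlt)
end

section
/- Let G ⊆ Mon(n,d) be stable with |G| = k. Then for every i ∈ ℕ: Σ_{a∈G} binom(m(a)−1, i) ≤ Σ_{a∈L(d,k)} binom(m(a)−1, i). (Via the Eliahou–Kervaire formula this says: among stable monomial ideals generated in degree d with k generators, the lex-segment ideal J(d,k) has the largest graded Betti numbers β_{i,i+d}; this is the stable case of the upper bound of Proposition 4.4.) -/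
/-! ### Monomials, colon sets and lex segments -/

/-- Exponent vectors of degree `d` supported on the variables of index at most `m`. -/
def InMon {n : ℕ} (m : Fin n) (d : ℕ) (a : Fin n → ℕ) : Prop :=
  (∀ j, m < j → a j = 0) ∧ ∑ i, a i = d

/-- The lex segments of `InMon m d`. -/
def IsLexSeg {n : ℕ} (m : Fin n) (d : ℕ) (L : Finset (Fin n → ℕ)) : Prop :=
  (∀ a ∈ L, InMon m d a) ∧ ∀ a ∈ L, ∀ b, InMon m d b → lexGT b a → b ∈ L

/-- Closure under replacing a variable of index at most `m` by an earlier one. -/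
def IsStronglyStable {n : ℕ} (m : Fin n) (G : Finset (Fin n → ℕ)) : Prop :=
  ∀ (a : Fin n → ℕ) (p q : Fin n), p < q → q ≤ m →
    a + Pi.single q 1 ∈ G → a + Pi.single p 1 ∈ G

/-- Closure under replacing the variable of index `m` by an earlier one. -/
def IsLastStable {n : ℕ} (m : Fin n) (G : Finset (Fin n → ℕ)) : Prop :=
  ∀ (a : Fin n → ℕ) (p : Fin n), p < m → a + Pi.single m 1 ∈ G → a + Pi.single p 1 ∈ G

/-- The exponent vectors `b` such that `x_m · x^b` belongs to `G`. -/
def colon {n : ℕ} (m : Fin n) (G : Finset (Fin n → ℕ)) : Finset (Fin n → ℕ) :=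
  (G.filter fun a => ¬ a m = 0).image fun a => a - Pi.single m 1

section

open Finset

variable {n : ℕ}

lemma sub_single_add_single {a : Fin n → ℕ} {m : Fin n} (h : a m ≠ 0) :
    a - Pi.single m 1 + Pi.single m 1 = a := by
  funext j
  by_cases hj : j = m
  · subst hj; simp; omega
  · simp [hj]

lemma mem_colon {m : Fin n} {G : Finset (Fin n → ℕ)} {b : Fin n → ℕ} :
    b ∈ colon m G ↔ b + Pi.single m 1 ∈ G := by
  simp only [colon, mem_image, mem_filter]
  constructor
  · rintro ⟨a, ⟨ha, h0⟩, rfl⟩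
    rwa [sub_single_add_single h0]
  · intro h
    exact ⟨_, ⟨h, by simp⟩, by simp⟩

lemma card_colon (m : Fin n) (G : Finset (Fin n → ℕ)) :
    (G.filter fun a => a m = 0).card + (colon m G).card = G.card := by
  rw [colon, card_image_of_injOn, card_filter_add_card_filter_not]
  intro a ha b hb h
  simp only [coe_filter, Set.mem_ofPred_eq] at ha hb
  rw [← sub_single_add_single ha.2, ← sub_single_add_single hb.2]
  exact congrArg (· + Pi.single m 1) h

lemma colon_subset_colon (m : Fin n) {G H : Finset (Fin n → ℕ)} (h : G ⊆ H) :
    colon m G ⊆ colon m H := fun _ hb => mem_colon.2 (h (mem_colon.1 hb))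

lemma sum_add_single (a : Fin n → ℕ) (m : Fin n) (k : ℕ) :
    ∑ i, (a + Pi.single m k : Fin n → ℕ) i = ∑ i, a i + k := by
  simp [sum_add_distrib]

lemma InMon.of_add_single {m p : Fin n} {d : ℕ} {a : Fin n → ℕ}
    (h : InMon m (d + 1) (a + Pi.single p 1)) : InMon m d a := by
  refine ⟨fun j hj => ?_, ?_⟩
  · have := h.1 j hj
    simp only [Pi.add_apply] at this
    omega
  · have := h.2
    rw [sum_add_single] at this
    omega

lemma InMon.add_single {m p : Fin n} {d : ℕ} {a : Fin n → ℕ} (h : InMon m d a) (hp : p ≤ m) :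
    InMon m (d + 1) (a + Pi.single p 1) := by
  refine ⟨fun j hj => ?_, by rw [sum_add_single, h.2]⟩
  have : j ≠ p := (hp.trans_lt hj).ne'
  simp [h.1 j hj, this]

lemma lexGT_iff_toLex_lt {a b : Fin n → ℕ} : lexGT a b ↔ toLex b < toLex a := by
  constructor
  · rintro ⟨r, h, h'⟩
    exact ⟨r, fun s hs => (h' s hs).symm, h⟩
  · rintro ⟨r, h, h'⟩
    exact ⟨r, h', fun s hs => (h s hs).symm⟩

lemma lexGT.trans {a b c : Fin n → ℕ} (h : lexGT a b) (h' : lexGT b c) : lexGT a c := by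
  rw [lexGT_iff_toLex_lt] at *
  exact h'.trans h

lemma lexGT.add_right {a b : Fin n → ℕ} (h : lexGT a b) (c : Fin n → ℕ) :
    lexGT (a + c) (b + c) := by
  obtain ⟨r, h, h'⟩ := h
  exact ⟨r, by simpa using h, fun s hs => by simp [h' s hs]⟩

/-- A lex segment contains lex segments of every smaller cardinality. -/
lemma IsLexSeg.exists_subset_card_eq {m : Fin n} {d k : ℕ} {L : Finset (Fin n → ℕ)}
    (hL : IsLexSeg m d L) (hk : k ≤ L.card) : ∃ K ⊆ L, IsLexSeg m d K ∧ K.card = k := by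
  induction hc : L.card - k generalizing L with
  | zero => exact ⟨L, Subset.rfl, hL, by omega⟩
  | succ t ih =>
    have hne : L.Nonempty := card_pos.1 (by omega)
    obtain ⟨u, huL, hu⟩ := exists_min_image L toLex hne
    have hcard := card_erase_of_mem huL
    have hseg : IsLexSeg m d (L.erase u) := by
      refine ⟨fun a ha => hL.1 a (mem_of_mem_erase ha), fun a ha b hb hba => ?_⟩
      refine mem_erase.2 ⟨?_, hL.2 a (mem_of_mem_erase ha) b hb hba⟩
      rintro rfl
      exact (lexGT_iff_toLex_lt.1 hba).not_ge (hu a (mem_of_mem_erase ha))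
    obtain ⟨K, hKL, hK⟩ := ih hseg (by omega) (by omega)
    exact ⟨K, hKL.trans (erase_subset _ _), hK⟩

/-- If `u = v + ε_p` where `p` is the last index in the support of `u`, then `v` is the
largest monomial whose product with a later variable `x_μ` is below `u`. -/
lemma lexGT_add_single_of_lexGT {m p : Fin n} {d : ℕ} {c v : Fin n → ℕ} (hpm : p < m)
    (hc : ∑ i, c i = d) (hv : ∑ i, v i = d) (hvp : ∀ j, p < j → v j = 0) (h : lexGT c v) :
    lexGT (c + Pi.single m 1) (v + Pi.single p 1) := by
  obtain ⟨r, hr, hs⟩ := h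
  have hrp : r < p := by
    by_contra hpr
    rw [not_lt] at hpr
    refine absurd (hv.trans hc.symm) (sum_lt_sum (fun i _ => ?_) ⟨r, mem_univ r, hr⟩).ne
    rcases lt_trichotomy i r with h | rfl | h
    · exact (hs i h).ge
    · exact hr.le
    · simp [hvp i (hpr.trans_lt h)]
  refine ⟨r, ?_, fun s hsr => ?_⟩
  · simp [hrp.ne, (hrp.trans hpm).ne, hr]
  · simp [(hsr.trans hrp).ne, ((hsr.trans hrp).trans hpm).ne, hs s hsr]

lemma lexGT_add_single_succ {b u : Fin n → ℕ} {p q : Fin n} (hpq : (q : ℕ) = p + 1)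
    (hb : ∀ j, p < j → b j = 0) (hu : u q = 0) (h : lexGT (b + Pi.single p 1) u) :
    lexGT (b + Pi.single q 1) u := by
  have hlt : p < q := by simp only [Fin.lt_def]; omega
  obtain ⟨r, hr, hs⟩ := h
  rcases lt_trichotomy r p with h | rfl | h
  · refine ⟨r, ?_, fun s hsr => ?_⟩
    · simpa [h.ne, (h.trans hlt).ne] using hr
    · simpa [(hsr.trans h).ne, ((hsr.trans h).trans hlt).ne] using hs s hsr
  · simp only [Pi.add_apply, Pi.single_eq_same] at hr
    rcases (Nat.lt_succ_iff.1 hr).lt_or_eq with h | h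
    · refine ⟨r, by simpa [hlt.ne] using h, fun s hsr => ?_⟩
      simpa [hsr.ne, (hsr.trans hlt).ne] using hs s hsr
    · refine ⟨q, by simp [hu], fun s hsq => ?_⟩
      have hsr : s ≤ r := by simp only [Fin.lt_def, Fin.le_def] at *; omega
      rcases hsr.lt_or_eq with hsr | rfl
      · simpa [hsr.ne, hsq.ne] using hs s hsr
      · simp [hsq.ne, h]
  · simp [hb r h, h.ne'] at hr

/-- Restricting to the monomials free of the last variable, lex segments shrink at least as
much as strongly stable sets. -/
theorem IsStronglyStable.card_filter_lexSeg_le (m : ℕ) (hm : m < n) (d : ℕ)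
    (G L : Finset (Fin n → ℕ)) (hG : ∀ a ∈ G, InMon ⟨m, hm⟩ d a)
    (hGs : IsStronglyStable ⟨m, hm⟩ G) (hL : IsLexSeg ⟨m, hm⟩ d L) (hcard : L.card ≤ G.card) :
    (L.filter fun a => a ⟨m, hm⟩ = 0).card ≤ (G.filter fun a => a ⟨m, hm⟩ = 0).card := by
  induction m generalizing d G L with
  | zero =>
    rcases Nat.eq_zero_or_pos d with rfl | hd
    · have key : ∀ a, InMon ⟨0, hm⟩ 0 a → a ⟨0, hm⟩ = 0 := fun a ha =>
        (Finset.sum_eq_zero_iff.1 ha.2) _ (mem_univ _)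
      rwa [filter_true_of_mem fun a ha => key a (hL.1 a ha),
        filter_true_of_mem fun a ha => key a (hG a ha)]
    · rw [filter_false_of_mem]
      · simp
      · intro a ha h0
        obtain ⟨h1, h2⟩ := hL.1 a ha
        have : ∑ i, a i = 0 := sum_eq_zero fun i _ => by
          rcases Nat.eq_zero_or_pos i with hi | hi
          · rwa [show i = ⟨0, hm⟩ from Fin.ext hi]
          · exact h1 i hi
        omega
  | succ m ihm =>
    have hm' : m < n := by omega
    set μ : Fin n := ⟨m + 1, hm⟩ with hμ
    set ν : Fin n := ⟨m, hm'⟩ with hν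
    have hνμ : ν < μ := by simp [hμ, hν, Fin.lt_def]
    have hsucc : ∀ {j : Fin n}, ν < j → j ≠ μ → μ < j := fun {j} h h' => by
      have := Fin.val_ne_of_ne h'
      simp only [hμ, hν, Fin.lt_def] at *
      omega
    have hres : ∀ {d a}, InMon μ d a → a μ = 0 → InMon ν d a := fun {d a} h h0 =>
      ⟨fun j hj => by
        by_cases hjμ : j = μ
        · rwa [hjμ]
        · exact h.1 j (hsucc hj hjμ), h.2⟩
    have hext : ∀ {d a}, InMon ν d a → InMon μ d a := fun {d a} h =>
      ⟨fun j hj => h.1 j (hνμ.trans hj), h.2⟩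
    induction d generalizing G L with
    | zero =>
      have key : ∀ a, InMon μ 0 a → a μ = 0 := fun a ha =>
        (Finset.sum_eq_zero_iff.1 ha.2) _ (mem_univ _)
      rwa [filter_true_of_mem fun a ha => key a (hL.1 a ha),
        filter_true_of_mem fun a ha => key a (hG a ha)]
    | succ d ihd =>
      by_contra! hlt
      set G₀ := G.filter fun a => a μ = 0 with hG₀
      obtain ⟨u, hu₀, hmin⟩ := exists_min_image (L.filter fun a => a μ = 0) toLex
        (card_pos.1 (by omega))
      obtain ⟨huL, huμ⟩ := mem_filter.1 hu₀
      have huM := hL.1 u huL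
      classical
      set L' := L.filter fun a => lexGT a u with hL'
      set L₀' := L'.filter fun a => a μ = 0 with hL₀'
      have memL' : ∀ {a}, InMon μ (d + 1) a → lexGT a u → a ∈ L' := fun {a} ha h =>
        mem_filter.2 ⟨hL.2 u huL a ha h, h⟩
      have hu_notMem : u ∉ L' := fun h =>
        (lexGT_iff_toLex_lt.1 (mem_filter.1 h).2).false
      have hL₀card : L₀'.card + 1 = (L.filter fun a => a μ = 0).card := by
        rw [← card_insert_of_notMem (a := u) (fun h => hu_notMem (mem_filter.1 h).1)]
        congr 1
        ext a
        simp only [mem_insert, hL', mem_filter]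
        constructor
        · rintro (rfl | ⟨⟨h1, -⟩, h2⟩)
          exacts [⟨huL, huμ⟩, ⟨h1, h2⟩]
        · intro h
          rcases (hmin a (mem_filter.2 h)).lt_or_eq with h' | h'
          · exact Or.inr ⟨⟨h.1, lexGT_iff_toLex_lt.2 h'⟩, h.2⟩
          · exact Or.inl (toLex.injective h').symm
      obtain ⟨p, hp, hpmax⟩ := exists_max_image (univ.filter fun i => u i ≠ 0) id (by
        by_contra hne
        rw [not_nonempty_iff_eq_empty, filter_eq_empty_iff] at hne
        have : ∑ i, u i = 0 := sum_eq_zero fun i hi => not_not.1 (hne hi)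
        have := huM.2
        omega)
      have hup : u p ≠ 0 := (mem_filter.1 hp).2
      have hpμ : p < μ := by
        refine lt_of_le_of_ne (not_lt.1 fun h => hup (huM.1 p h)) ?_
        rintro rfl
        exact hup huμ
      set v := u - Pi.single p 1 with hv
      have huv : v + Pi.single p 1 = u := sub_single_add_single hup
      have hvM : InMon μ d v := InMon.of_add_single (p := p) (by rwa [huv])
      have hvp : ∀ j, p < j → v j = 0 := fun j hj => by
        have : u j = 0 := by
          by_contra h
          exact hj.not_ge (hpmax j (mem_filter.2 ⟨mem_univ j, h⟩))
        simp [hv, this]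
      have hv_notMem : v ∉ colon μ L' := by
        intro h
        have h1 := (mem_filter.1 (mem_colon.1 h)).2
        have h2 : lexGT u (v + Pi.single μ 1) := by
          refine ⟨p, ?_, fun s hs => ?_⟩
          · simp [← huv, hpμ.ne]
          · simp [← huv, hs.ne, (hs.trans hpμ).ne]
        exact (lexGT_iff_toLex_lt.1 (h1.trans h2)).false
      set K := insert v (colon μ L') with hK
      have hKseg : IsLexSeg μ d K := by
        refine ⟨fun a ha => ?_, fun a ha b hb hba => mem_insert_of_mem (mem_colon.2 ?_)⟩
        · rcases mem_insert.1 ha with rfl | ha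
          · exact hvM
          · exact (hL.1 _ (mem_filter.1 (mem_colon.1 ha)).1).of_add_single
        · refine memL' (hb.add_single le_rfl) ?_
          rcases mem_insert.1 ha with rfl | ha
          · rw [← huv]
            exact lexGT_add_single_of_lexGT hpμ hb.2 hvM.2 hvp hba
          · exact (hba.add_right _).trans (mem_filter.1 (mem_colon.1 ha)).2
      have hKcard : K.card = (colon μ L').card + 1 := card_insert_of_notMem hv_notMem
      have hK₀card : (K.filter fun a => a μ = 0).card
          = ((colon μ L').filter fun a => a μ = 0).card + 1 := by
        rw [hK, filter_insert, if_pos (hvp μ hpμ),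
          card_insert_of_notMem fun h => hv_notMem (mem_filter.1 h).1]
      have h1 := card_colon μ L
      have h2 : G₀.card + (colon μ G).card = G.card := card_colon μ G
      have h3 : (colon μ L').card ≤ (colon μ L).card :=
        card_le_card (colon_subset_colon μ (filter_subset _ L))
      have hDmon : ∀ a ∈ colon μ G, InMon μ d a := fun a ha =>
        (hG _ (mem_colon.1 ha)).of_add_single
      have hDs : IsStronglyStable μ (colon μ G) := fun a p q hpq hq ha => by
        rw [mem_colon, add_right_comm] at ha ⊢
        exact hGs _ p q hpq hq ha
      have h4 := ihd (colon μ G) K (by omega) hDmon hDs hKseg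
      have h5 : ((colon μ G).filter fun a => a μ = 0) ⊆ colon ν G₀ := fun b hb => by
        obtain ⟨hb, hb0⟩ := mem_filter.1 hb
        refine mem_colon.2 (mem_filter.2 ⟨hGs _ ν μ hνμ le_rfl (mem_colon.1 hb), ?_⟩)
        simp [hb0, hνμ.ne']
      have h5 := card_le_card h5
      have hL₀'seg : IsLexSeg ν (d + 1) L₀' := by
        refine ⟨fun a ha => ?_, fun a ha b hb hba => ?_⟩
        · obtain ⟨ha, ha0⟩ := mem_filter.1 ha
          exact hres (hL.1 a (mem_filter.1 ha).1) ha0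
        · refine mem_filter.2 ⟨memL' (hext hb) (hba.trans ?_), hb.1 μ hνμ⟩
          exact (mem_filter.1 (mem_filter.1 ha).1).2
      obtain ⟨N, hNL, hNseg, hNcard⟩ := hL₀'seg.exists_subset_card_eq (k := G₀.card) (by omega)
      have h6 := ihm hm' (d + 1) G₀ N
        (fun a ha => hres (hG a (mem_filter.1 ha).1) (mem_filter.1 ha).2)
        (fun a p q hpq hq ha => by
          obtain ⟨ha, ha0⟩ := mem_filter.1 ha
          refine mem_filter.2 ⟨hGs a p q hpq (hq.trans hνμ.le) ha, ?_⟩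
          have h1 : μ ≠ p := ((hpq.trans_le hq).trans hνμ).ne'
          simp only [Pi.add_apply] at ha0 ⊢
          simp [h1]
          omega) hNseg hNcard.le
      rw [← hν] at h6
      have h7 := card_colon ν N
      have h8 := card_colon ν G₀
      have h9 : colon ν N ⊆ (colon μ L').filter fun a => a μ = 0 := fun b hb => by
        have hb := mem_colon.1 hb
        have hbM : InMon ν d b := (hNseg.1 _ hb).of_add_single
        refine mem_filter.2 ⟨mem_colon.2 (memL' ((hext hbM).add_single le_rfl) ?_),
          hbM.1 μ hνμ⟩
        exact lexGT_add_single_succ rfl hbM.1 huμ (mem_filter.1 (mem_filter.1 (hNL hb)).1).2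
      have h9 := card_le_card h9
      omega

/-! ### Compression in two variables -/

/-- If `Q` holds at both `t` and `t + 1` whenever `P` holds at `t`, then `Q` is satisfied at
least once more than `P`. -/
lemma count_add_one_le_count_succ {P Q : ℕ → Prop} [DecidablePred P] [DecidablePred Q]
    (h : ∀ t, P t → Q t ∧ Q (t + 1)) {N : ℕ} (hN : 0 < Nat.count P N) :
    Nat.count P N + 1 ≤ Nat.count Q (N + 1) := by
  induction N with
  | zero => simp at hN
  | succ N ih =>
    have hmono : Nat.count P N ≤ Nat.count Q N := Nat.count_mono_left fun k _ hk => (h k hk).1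
    rw [Nat.count_succ] at hN
    rw [Nat.count_succ P, Nat.count_succ Q]
    by_cases hP : P N
    · have := Nat.count_succ Q N
      simp only [hP, (h N hP).1, (h N hP).2, if_true] at *
      omega
    · simp only [hP, if_false, add_zero] at *
      have := ih hN
      omega

lemma exists_count_eq {P : ℕ → Prop} [DecidablePred P] {j N : ℕ} (h : j < Nat.count P N) :
    ∃ t < N, P t ∧ Nat.count P t = j := by
  induction N with
  | zero => simp at h
  | succ N ih =>
    rw [Nat.count_succ] at h
    by_cases hj : j < Nat.count P N
    · obtain ⟨t, ht, h'⟩ := ih hj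
      exact ⟨t, by omega, h'⟩
    · by_cases hP : P N
      · exact ⟨N, by omega, hP, by simp only [hP, if_true] at h; omega⟩
      · simp [hP] at h; omega

/-- Redistribute the exponents of the variables `p` and `q`, giving `t` to `q`. -/
def redistribute (p q : Fin n) (a : Fin n → ℕ) (t : ℕ) : Fin n → ℕ :=
  fun i => if i = q then t else if i = p then a p + a q - t else a i

/-- The admissible exponents of `q` among the redistributions of `a` lying in `G`. -/
def LineMem (p q : Fin n) (G : Finset (Fin n → ℕ)) (a : Fin n → ℕ) (t : ℕ) : Prop :=
  t ≤ a p + a q ∧ redistribute p q a t ∈ G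

instance (p q : Fin n) (G : Finset (Fin n → ℕ)) (a : Fin n → ℕ) :
    DecidablePred (LineMem p q G a) := fun t => by
  unfold LineMem
  infer_instance

/-- Push `a` as far towards `x_p` as its rank among its redistributions in `G` allows. -/
def compressElt (p q : Fin n) (G : Finset (Fin n → ℕ)) (a : Fin n → ℕ) : Fin n → ℕ :=
  redistribute p q a (Nat.count (LineMem p q G a) (a q))

/-- Compression of `G` in the variables `p` and `q`. -/
def compress (p q : Fin n) (G : Finset (Fin n → ℕ)) : Finset (Fin n → ℕ) :=
  G.image (compressElt p q G)

lemma redistribute_self {p q : Fin n} (a : Fin n → ℕ) :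
    redistribute p q a (a q) = a := by
  funext i
  simp only [redistribute]
  split_ifs with h1 h2
  · rw [h1]
  · rw [h2]; omega
  · rfl

lemma redistribute_redistribute {p q : Fin n} (hpq : p ≠ q) (a : Fin n → ℕ) {s : ℕ} (t : ℕ)
    (hs : s ≤ a p + a q) : redistribute p q (redistribute p q a s) t = redistribute p q a t := by
  funext i
  simp only [redistribute, hpq, if_true, if_false]
  split_ifs
  · rfl
  · omega
  · rfl

lemma lineMem_redistribute {p q : Fin n} (hpq : p ≠ q) (G : Finset (Fin n → ℕ))
    (a : Fin n → ℕ) {s : ℕ} (hs : s ≤ a p + a q) :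
    LineMem p q G (redistribute p q a s) = LineMem p q G a := by
  funext t
  simp only [LineMem, redistribute_redistribute hpq a t hs]
  simp only [redistribute, hpq, if_true, if_false]
  rw [Nat.sub_add_cancel hs]

lemma count_lineMem_congr {p q : Fin n} {G : Finset (Fin n → ℕ)} {a b : Fin n → ℕ}
    (h : LineMem p q G a = LineMem p q G b) (k : ℕ) :
    Nat.count (LineMem p q G a) k = Nat.count (LineMem p q G b) k := by
  simp only [Nat.count_eq_card_filter_range, h]

lemma lineMem_self {p q : Fin n} {G : Finset (Fin n → ℕ)} {a : Fin n → ℕ} (ha : a ∈ G) :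
    LineMem p q G a (a q) := ⟨by omega, by rwa [redistribute_self]⟩

lemma count_lineMem_le {p q : Fin n} {G : Finset (Fin n → ℕ)} {a : Fin n → ℕ} :
    Nat.count (LineMem p q G a) (a q) ≤ a p + a q :=
  (Nat.count_le (p := LineMem p q G a)).trans (by omega)

lemma mem_compress {p q : Fin n} (hpq : p ≠ q) {G : Finset (Fin n → ℕ)} {c : Fin n → ℕ} :
    c ∈ compress p q G ↔ c q < Nat.count (LineMem p q G c) (c p + c q + 1) := by
  rw [compress, mem_image]
  constructor
  · rintro ⟨a, ha, rfl⟩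
    rw [compressElt, count_lineMem_congr (lineMem_redistribute hpq G a count_lineMem_le)]
    simp only [redistribute, hpq, if_true, if_false]
    rw [Nat.sub_add_cancel count_lineMem_le]
    exact Nat.count_strict_mono (lineMem_self ha) (by omega)
  · intro h
    obtain ⟨t, ht, hPt, hct⟩ := exists_count_eq h
    refine ⟨redistribute p q c t, hPt.2, ?_⟩
    rw [compressElt, redistribute_redistribute hpq _ _ hPt.1,
      count_lineMem_congr (lineMem_redistribute hpq G c hPt.1)]
    simp only [redistribute, if_true]
    rw [hct]
    exact redistribute_self c

lemma compressElt_injOn {p q : Fin n} (hpq : p ≠ q) (G : Finset (Fin n → ℕ)) :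
    Set.InjOn (compressElt p q G) G := by
  intro a ha b hb h
  have hP : LineMem p q G a = LineMem p q G b := by
    have := congrArg (LineMem p q G) h
    rwa [compressElt, compressElt, lineMem_redistribute hpq G a count_lineMem_le,
      lineMem_redistribute hpq G b count_lineMem_le] at this
  have hr := congrFun h q
  simp only [compressElt, redistribute, if_true] at hr
  rw [count_lineMem_congr hP] at hr
  have hq : a q = b q :=
    Nat.count_injective (p := LineMem p q G b) (hP ▸ lineMem_self ha) (lineMem_self hb) hr
  have := congrArg (fun c => redistribute p q c (a q)) h
  simp only [compressElt, redistribute_redistribute hpq _ _ count_lineMem_le,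
    redistribute_self] at this
  rw [this, hq, redistribute_self]

lemma redistribute_of_ne {p q i : Fin n} (hp : i ≠ p) (hq : i ≠ q) (a : Fin n → ℕ) (t : ℕ) :
    redistribute p q a t i = a i := by
  simp [redistribute, hp, hq]

lemma redistribute_add_single {p q : Fin n} (hpq : p ≠ q) (a : Fin n → ℕ) {t : ℕ}
    (ht : t ≤ a q) :
    redistribute p q a t + Pi.single q (a q - t) = a + Pi.single p (a q - t) := by
  funext i
  by_cases hq : i = q
  · subst hq
    simp [redistribute, hpq.symm]
    omega
  · by_cases hp : i = p
    · subst hp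
      simp [redistribute, hpq]
      omega
    · simp [redistribute, hp, hq]

lemma sum_compressElt {p q : Fin n} (hpq : p ≠ q) (G : Finset (Fin n → ℕ)) (a : Fin n → ℕ) :
    ∑ i, compressElt p q G a i = ∑ i, a i := by
  have := congrArg (fun c : Fin n → ℕ => ∑ i, c i)
    (redistribute_add_single hpq a (Nat.count_le (p := LineMem p q G a)))
  simp only [sum_add_single] at this
  exact Nat.add_right_cancel this

/-- The weight of a monomial: the sum of the indices of its variables. -/
def weight (a : Fin n → ℕ) : ℕ := ∑ i : Fin n, (i : ℕ) * a i

lemma weight_add_single (a : Fin n → ℕ) (m : Fin n) (k : ℕ) :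
    weight (a + Pi.single m k) = weight a + m * k := by
  simp [weight, mul_add, sum_add_distrib, Pi.single_apply]

lemma weight_compressElt {p q : Fin n} (hpq : p < q) (G : Finset (Fin n → ℕ))
    (a : Fin n → ℕ) : weight (compressElt p q G a) ≤ weight a ∧
      (compressElt p q G a ≠ a → weight (compressElt p q G a) < weight a) := by
  have hle := Nat.count_le (p := LineMem p q G a) (n := a q)
  have := congrArg weight (redistribute_add_single hpq.ne a hle)
  simp only [weight_add_single] at this
  rw [← compressElt] at this
  rcases hle.lt_or_eq with h | h
  · have := Nat.mul_lt_mul_of_pos_right (Fin.lt_def.1 hpq) (Nat.sub_pos_of_lt h)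
    exact ⟨by omega, fun _ => by omega⟩
  · have : compressElt p q G a = a := by rw [compressElt, h, redistribute_self]
    exact ⟨by rw [this], fun h' => absurd this h'⟩

lemma redistribute_add_single_of_ne {p q i : Fin n} (hp : i ≠ p) (hq : i ≠ q)
    (a : Fin n → ℕ) (t k : ℕ) : redistribute p q (a + Pi.single i k) t
      = redistribute p q a t + Pi.single i k := by
  funext j
  by_cases h : j = i
  · subst h; simp [redistribute, hp, hq]
  · simp [redistribute, h, hp.symm, hq.symm]

lemma redistribute_eq_add_single_left {p q : Fin n} (hpq : p ≠ q) {a c : Fin n → ℕ} {t : ℕ}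
    (ht : t ≤ a p + a q) (hc : c p + c q = a p + a q + 1)
    (h : ∀ i, i ≠ p → i ≠ q → c i = a i) :
    redistribute p q c t = redistribute p q a t + Pi.single p 1 := by
  funext j
  by_cases hq : j = q
  · subst hq; simp [redistribute, hpq.symm]
  · by_cases hp : j = p
    · subst hp; simp [redistribute, hpq]; omega
    · simp [redistribute, hp, hq, h]

lemma redistribute_eq_add_single_right {p q : Fin n} (hpq : p ≠ q) {a c : Fin n → ℕ} {t : ℕ}
    (hc : c p + c q = a p + a q + 1) (h : ∀ i, i ≠ p → i ≠ q → c i = a i) :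
    redistribute p q c (t + 1) = redistribute p q a t + Pi.single q 1 := by
  funext j
  by_cases hq : j = q
  · subst hq; simp [redistribute]
  · by_cases hp : j = p
    · subst hp; simp [redistribute, hpq]; omega
    · simp [redistribute, hp, hq, h]

lemma IsLastStable.isLastStable_compress {m p q : Fin n} {G : Finset (Fin n → ℕ)}
    (hG : IsLastStable m G) (hpq : p < q) (hqm : q < m) : IsLastStable m (compress p q G) := by
  intro b i him hb
  have hpm := hpq.trans hqm
  rw [mem_compress hpq.ne] at hb ⊢
  have hline : ∀ t, LineMem p q G (b + Pi.single m 1) t →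
      t ≤ b p + b q ∧ redistribute p q b t + Pi.single m 1 ∈ G := by
    intro t ht
    rw [LineMem, redistribute_add_single_of_ne hpm.ne' hqm.ne'] at ht
    simpa [hpm.ne, hqm.ne] using ht
  have hbpq : ∀ j, j ≠ m → (b + Pi.single m 1 : Fin n → ℕ) j = b j := fun j hj => by simp [hj]
  rw [hbpq p hpm.ne, hbpq q hqm.ne] at hb
  by_cases hi : i ≠ p ∧ i ≠ q
  · have hci : ∀ j, j ≠ i → (b + Pi.single i 1 : Fin n → ℕ) j = b j := fun j hj => by simp [hj]
    rw [hci p hi.1.symm, hci q hi.2.symm]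
    refine hb.trans_le (Nat.count_mono_left fun t _ ht => ?_)
    obtain ⟨h1, h2⟩ := hline t ht
    refine ⟨by rwa [hci p hi.1.symm, hci q hi.2.symm], ?_⟩
    rw [redistribute_add_single_of_ne hi.1 hi.2]
    exact hG _ i him h2
  · have hi' : i = p ∨ i = q := by tauto
    have hsum : (b + Pi.single i 1 : Fin n → ℕ) p + (b + Pi.single i 1 : Fin n → ℕ) q
        = b p + b q + 1 := by
      rcases hi' with rfl | rfl
      · simp [hpq.ne']; omega
      · simp [hpq.ne]; omega
    have hother : ∀ j, j ≠ p → j ≠ q → (b + Pi.single i 1 : Fin n → ℕ) j = b j := by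
      intro j hjp hjq
      have : j ≠ i := by rcases hi' with rfl | rfl <;> assumption
      simp [this]
    have hq1 : (b + Pi.single i 1 : Fin n → ℕ) q ≤ b q + 1 := by
      rcases hi' with rfl | rfl <;> simp [hpq.ne']
    have := count_add_one_le_count_succ (Q := LineMem p q G (b + Pi.single i 1))
      (fun t ht => by
        obtain ⟨h1, h2⟩ := hline t ht
        refine ⟨⟨by omega, ?_⟩, by omega, ?_⟩
        · rw [redistribute_eq_add_single_left hpq.ne h1 hsum hother]
          exact hG _ p hpm h2
        · rw [redistribute_eq_add_single_right hpq.ne hsum hother]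
          exact hG _ q hqm h2) (Nat.zero_lt_of_lt hb)
    rw [hsum]
    omega

/-- Restricting to the monomials free of the last variable, lex segments shrink at least as
much as sets stable under replacing the last variable. -/
theorem IsLastStable.card_filter_lexSeg_le (m : Fin n) (d : ℕ) (G L : Finset (Fin n → ℕ))
    (hG : ∀ a ∈ G, InMon m d a) (hGs : IsLastStable m G) (hL : IsLexSeg m d L)
    (hcard : L.card ≤ G.card) :
    (L.filter fun a => a m = 0).card ≤ (G.filter fun a => a m = 0).card := by
  induction hw : ∑ a ∈ G, weight a using Nat.strong_induction_on generalizing G with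
  | _ w ih =>
    subst hw
    by_cases hs : IsStronglyStable m G
    · exact IsStronglyStable.card_filter_lexSeg_le m m.2 d G L hG hs hL hcard
    · simp only [IsStronglyStable, not_forall] at hs
      obtain ⟨a, p, q, hpq, hqm, hq, hp⟩ := hs
      have hqm : q < m := lt_of_le_of_ne hqm fun h => hp (hGs a p (h ▸ hpq) (h ▸ hq))
      have hinj := compressElt_injOn hpq.ne G
      have hoff : ∀ j, q < j → ∀ a, compressElt p q G a j = a j := fun j hj a =>
        redistribute_of_ne (hpq.trans hj).ne' hj.ne' _ _
      have hfilter : ((compress p q G).filter fun a => a m = 0).card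
          = (G.filter fun a => a m = 0).card := by
        rw [compress, filter_image, card_image_of_injOn (hinj.mono fun b hb => (mem_filter.1 hb).1)]
        simp only [hoff m hqm]
      rw [← hfilter]
      refine ih _ ?_ _ ?_ (hGs.isLastStable_compress hpq hqm) ?_ rfl
      · rw [compress, sum_image hinj]
        refine sum_lt_sum (fun b _ => (weight_compressElt hpq G b).1)
          ⟨_, hq, (weight_compressElt hpq G _).2 fun hfix => hp ?_⟩
        have hrank := congrFun hfix q
        simp only [compressElt, redistribute, if_true] at hrank
        have h2 := (Nat.count_iff_forall.1 hrank (a q) (by simp)).2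
        convert h2 using 1
        funext j
        by_cases hjq : j = q
        · subst hjq; simp [redistribute, hpq.ne']
        · by_cases hjp : j = p
          · subst hjp; simp [redistribute, hpq.ne]; omega
          · simp [redistribute, hjp, hjq]
      · intro b hb
        obtain ⟨c, hc, rfl⟩ := mem_image.1 hb
        obtain ⟨h1, h2⟩ := hG c hc
        exact ⟨fun j hj => by rw [hoff j (hqm.trans hj), h1 j hj],
          by rw [sum_compressElt hpq.ne, h2]⟩
      · rwa [compress, card_image_of_injOn hinj]

/-! ### Betti numbers -/

lemma maxIdx_le_iff {a : Fin n → ℕ} {m : ℕ} :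
    maxIdx a ≤ m ↔ ∀ j : Fin n, m < j → a j = 0 := by
  simp only [maxIdx, Finset.sup_le_iff, mem_filter, mem_univ, true_and]
  exact forall_congr' fun j => by rw [← not_lt]; tauto

lemma IsStableSet.isLastStable {G : Finset (Fin n → ℕ)} (hG : IsStableSet G) (m : Fin n) :
    IsLastStable m (G.filter fun a => maxIdx a ≤ m) := by
  intro b p hpm hb
  obtain ⟨hb, hle⟩ := mem_filter.1 hb
  have hzero := maxIdx_le_iff.1 hle
  have hmax : maxIdx (b + Pi.single m 1) = m := by
    refine hle.antisymm (not_lt.1 fun hlt => ?_)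
    simpa using maxIdx_le_iff.1 le_rfl m hlt
  have hmove : moveDown (b + Pi.single m 1) p = b + Pi.single p 1 := by
    funext j
    simp only [moveDown, hmax, Pi.add_apply, Pi.single_apply, Fin.ext_iff]
    split_ifs <;> omega
  have hmem := hG _ hb p (by rw [hmax]; exact hpm)
  rw [hmove] at hmem
  refine mem_filter.2 ⟨hmem, maxIdx_le_iff.2 fun j hj => ?_⟩
  have h1 := hzero j hj
  have h2 : j ≠ p := (hpm.trans hj).ne'
  simp only [Pi.add_apply] at h1
  simp only [Pi.add_apply, Pi.single_eq_of_ne h2]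
  omega

/-- A stable set has at least as many monomials in the first variables as the lex segment of
the same cardinality. -/
lemma IsStableSet.card_filter_maxIdx_le {d : ℕ} {G L : Finset (Fin n → ℕ)}
    (hG : ∀ a ∈ G, ∑ i, a i = d) (hGs : IsStableSet G) (hL : ∀ a ∈ L, ∑ i, a i = d)
    (hLs : ∀ a ∈ L, ∀ b : Fin n → ℕ, (∑ i, b i) = d → lexGT b a → b ∈ L)
    (hcard : L.card ≤ G.card) (m : ℕ) :
    (L.filter fun a => maxIdx a ≤ m).card ≤ (G.filter fun a => maxIdx a ≤ m).card := by
  induction hk : n - m generalizing m with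
  | zero =>
    have hall : ∀ a : Fin n → ℕ, maxIdx a ≤ m := fun a =>
      maxIdx_le_iff.2 fun j hj => by have := j.2; omega
    simpa [hall] using hcard
  | succ k ih =>
    have ih := ih (m + 1) (by omega)
    by_cases hm : m + 1 < n
    · have hiff : ∀ a : Fin n → ℕ,
          (maxIdx a ≤ m + 1 ∧ a ⟨m + 1, hm⟩ = 0) ↔ maxIdx a ≤ m := fun a => by
        simp only [maxIdx_le_iff]
        constructor
        · rintro ⟨h1, h2⟩ j hj
          rcases (Nat.succ_le_of_lt hj).lt_or_eq with h | h
          · exact h1 j h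
          · rwa [show j = ⟨m + 1, hm⟩ from Fin.ext h.symm]
        · exact fun h => ⟨fun j hj => h j (by omega), h _ (by simp)⟩
      have hmon : ∀ {a : Fin n → ℕ}, ∑ i, a i = d → maxIdx a ≤ m + 1 →
          InMon ⟨m + 1, hm⟩ d a := fun {a} h h' => ⟨fun j hj => maxIdx_le_iff.1 h' j hj, h⟩
      have := IsLastStable.card_filter_lexSeg_le ⟨m + 1, hm⟩ d _
        (L.filter fun a => maxIdx a ≤ m + 1)
        (fun a ha => hmon (hG a (mem_filter.1 ha).1) (mem_filter.1 ha).2)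
        (hGs.isLastStable ⟨m + 1, hm⟩)
        ⟨fun a ha => hmon (hL a (mem_filter.1 ha).1) (mem_filter.1 ha).2, fun a ha b hb hba =>
          mem_filter.2 ⟨hLs a (mem_filter.1 ha).1 b hb.2 hba, maxIdx_le_iff.2 hb.1⟩⟩ ih
      simpa only [filter_filter, hiff] using this
    · have hall : ∀ a : Fin n → ℕ, maxIdx a ≤ m := fun a =>
        maxIdx_le_iff.2 fun j hj => by have := j.2; omega
      simpa [hall] using hcard

/-- Comparison of sums of a monotone function from a comparison of distribution functions. -/
lemma sum_comp_le_sum_comp {α : Type*} {G L : Finset α} {g : α → ℕ} {f : ℕ → ℕ}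
    (hf : Monotone f) (hcard : G.card = L.card)
    (h : ∀ m, (L.filter fun a => g a ≤ m).card ≤ (G.filter fun a => g a ≤ m).card) :
    ∑ a ∈ G, f (g a) ≤ ∑ a ∈ L, f (g a) := by
  classical
  obtain ⟨N, hN⟩ : ∃ N, ∀ a ∈ G ∪ L, g a ≤ N :=
    ⟨(G ∪ L).sup g, fun a ha => le_sup (f := g) ha⟩
  have hrepr : ∀ S ⊆ G ∪ L, ∑ a ∈ S, f (g a)
      = S.card * f 0 + ∑ m ∈ range N, (S.filter fun a => ¬ g a ≤ m).card * (f (m + 1) - f m) := by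
    intro S hS
    simp only [card_filter, sum_mul]
    rw [sum_comm, ← smul_eq_mul, ← sum_const, ← sum_add_distrib]
    refine sum_congr rfl fun a ha => ?_
    have hsub : range (g a) ⊆ range N := range_subset_range.2 (hN a (hS ha))
    rw [← sum_subset hsub]
    · rw [sum_congr rfl fun m hm => by rw [if_pos (not_le.2 (mem_range.1 hm)), one_mul],
        sum_range_tsub hf]
      have := hf (Nat.zero_le (g a))
      omega
    · intro m _ hm
      rw [if_neg (by simpa using hm), zero_mul]
  rw [hrepr G subset_union_left, hrepr L subset_union_right, hcard]
  refine Nat.add_le_add_left (sum_le_sum fun m _ => Nat.mul_le_mul_right _ ?_) _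
  have h1 := card_filter_add_card_filter_not (s := G) fun a => g a ≤ m
  have h2 := card_filter_add_card_filter_not (s := L) fun a => g a ≤ m
  have := h m
  omega

end

/-- stable case of Proposition 4.4: a stable set `G` of `k` monomials
of degree `d` satisfies `Σ_{a ∈ G} C(m(a)-1, i) ≤ Σ_{a ∈ L} C(m(a)-1, i)` where `L` is
the lex segment of length `k` in degree `d` (characterized as a `>_lex`-upward-closed
subset of the degree-`d` monomials of cardinality `k`); via the Eliahou–Kervaire formula
this bounds the Betti numbers of a stable ideal above by those of `J(d,k)`. -/
theorem stable_betti_le_lex_segment {n : ℕ} (hn : 1 ≤ n) (d : ℕ) (hd : 1 ≤ d) (k : ℕ)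
    (G : Finset (Fin n → ℕ)) (hGdeg : ∀ a ∈ G, ∑ i, a i = d)
    (hGstable : IsStableSet G) (hGcard : G.card = k)
    (L : Finset (Fin n → ℕ)) (hLdeg : ∀ a ∈ L, ∑ i, a i = d)
    (hLseg : ∀ a ∈ L, ∀ b : Fin n → ℕ, (∑ i, b i) = d → lexGT b a → b ∈ L)
    (hLcard : L.card = k) :
    ∀ i : ℕ, (∑ a ∈ G, Nat.choose (maxIdx a) i) ≤ ∑ a ∈ L, Nat.choose (maxIdx a) i := by
  intro i
  exact sum_comp_le_sum_comp (f := fun m => Nat.choose m i)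
    (fun _ _ h => Nat.choose_le_choose i h) (hGcard.trans hLcard.symm)
    (hGstable.card_filter_maxIdx_le hGdeg hLdeg hLseg (hLcard.trans hGcard.symm).le)
end
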